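/- arXiv:1305.4616 — 2 statements merged into one kernel-verified Lean document; each statement's English description precedes it below -/
import Mathlib

section
/- Let 1<p<∞ and 0<s<1 be such that sp<n, and let G ⊊ ℝⁿ be an open set, n ≥ 2, whose complement G^c is (s,p)-uniformly fat with constant σ. Then there is a constant c₀>0, depending only on s, n, p, and σ, such that for every u ∈ C_c^∞(G): ∫_G |u(x)|^p dist(x,∂G)^{-sp} dx ≤ c₀ ∫_{ℝⁿ} ∫_{ℝⁿ} |E_G u(x) − E_G u(y)|^p |x−y|^{-(n+sp)} dy dx. -/
open MeasureTheory Metric Set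
open scoped ENNReal NNReal Topology

noncomputable section

/-- Euclidean space `ℝⁿ`. -/
abbrev Euc (n : ℕ) := EuclideanSpace ℝ (Fin n)

/-- The `λ`-Hausdorff content of a set `E ⊆ ℝⁿ`:
`H^λ_∞(E) = inf { Σ_i r_i^λ : E ⊆ ⋃_i B(x_i, r_i), r_i > 0 }`. -/
def hContent (n : ℕ) (lam : ℝ) (E : Set (Euc n)) : ℝ≥0∞ :=
  ⨅ (c : ℕ → Euc n × ℝ) (_ : ∀ i, 0 < (c i).2)
    (_ : E ⊆ ⋃ i, Metric.ball (c i).1 (c i).2),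
    ∑' i, ENNReal.ofReal ((c i).2 ^ lam)

/-- The Riesz `(s,p)`-capacity of a set `E ⊆ ℝⁿ`:
`R_{s,p}(E) = inf { ‖f‖_p^p : f ≥ 0, I_s f ≥ 1 on E }`, where
`I_s f (x) = ∫ f(y) |x-y|^{s-n} dy`. -/
def rieszCap (n : ℕ) (s p : ℝ) (E : Set (Euc n)) : ℝ≥0∞ :=
  ⨅ (f : Euc n → ℝ) (_ : Measurable f) (_ : ∀ x, 0 ≤ f x)
    (_ : ∀ x ∈ E, 1 ≤ ∫⁻ y, ENNReal.ofReal (f y) * ENNReal.ofReal (dist x y ^ (s - (n : ℝ)))),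
    ∫⁻ x, ENNReal.ofReal (f x ^ p)

/-- A set `E ⊆ ℝⁿ` is `(s,p)`-uniformly fat:
`R_{s,p}(B(x,r) ∩ E) ≥ σ r^{n-sp}` for all `x ∈ E`, `r > 0`. -/
def UniformlyFat (n : ℕ) (s p : ℝ) (E : Set (Euc n)) : Prop :=
  ∃ σ : ℝ, 0 < σ ∧ ∀ x ∈ E, ∀ r : ℝ, 0 < r →
    ENNReal.ofReal (σ * r ^ ((n : ℝ) - s * p)) ≤ rieszCap n s p (Metric.ball x r ∩ E)

/-- A set `E ⊆ ℝⁿ` is locally `(s,p)`-uniformly fat: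
`R_{s,p}(B(x,r) ∩ E) ≥ σ r^{n-sp}` for all `x ∈ E`, `0 < r < r₀`. -/
def LocallyUniformlyFat (n : ℕ) (s p : ℝ) (E : Set (Euc n)) : Prop :=
  ∃ σ r₀ : ℝ, 0 < σ ∧ 0 < r₀ ∧ ∀ x ∈ E, ∀ r : ℝ, 0 < r → r < r₀ →
    ENNReal.ofReal (σ * r ^ ((n : ℝ) - s * p)) ≤ rieszCap n s p (Metric.ball x r ∩ E)

/-- An open set `G ⊆ ℝⁿ` admits the `(s,p)`-Hardy inequality:
`∫_G |u|^p dist(x,∂G)^{-sp} dx ≤ c ∫_G ∫_G |u(x)-u(y)|^p |x-y|^{-(n+sp)} dy dx`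
for every `u ∈ C_c^∞(G)`. -/
def AdmitsHardy (n : ℕ) (s p : ℝ) (G : Set (Euc n)) : Prop :=
  ∃ c : ℝ, 0 < c ∧ ∀ u : Euc n → ℝ,
    ContDiff ℝ (⊤ : ℕ∞) u → HasCompactSupport u → tsupport u ⊆ G →
    (∫⁻ x in G, ENNReal.ofReal (|u x| ^ p / Metric.infDist x (frontier G) ^ (s * p))) ≤
      ENNReal.ofReal c *
        ∫⁻ x in G, ∫⁻ y in G, ENNReal.ofReal (|u x - u y| ^ p / dist x y ^ ((n : ℝ) + s * p))

/-- `U` is a `c`-John domain with center point `x₀`: every `x ∈ U` is joined to `x₀`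
by an arc-length-parameterized (here: 1-Lipschitz) curve `γ : [0,ℓ] → U` with
`dist(γ(t), ∂U) ≥ t/c`. -/
def IsJohnDomain (n : ℕ) (c : ℝ) (U : Set (Euc n)) (x₀ : Euc n) : Prop :=
  IsOpen U ∧ IsConnected U ∧ x₀ ∈ U ∧
  ∀ x ∈ U, ∃ ℓ : ℝ, 0 ≤ ℓ ∧ ∃ γ : ℝ → Euc n,
    LipschitzOnWith 1 γ (Set.Icc 0 ℓ) ∧ γ 0 = x ∧ γ ℓ = x₀ ∧
    ∀ t ∈ Set.Icc 0 ℓ, γ t ∈ U ∧ t / c ≤ Metric.infDist (γ t) (frontier U)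

/-- `G_{x,c}`: the union of all `c`-John subdomains of `G` with center point `x`. -/
def johnPart (n : ℕ) (c : ℝ) (G : Set (Euc n)) (x : Euc n) : Set (Euc n) :=
  ⋃₀ {U : Set (Euc n) | U ⊆ G ∧ IsJohnDomain n c U x}

/-- The `c`-visual boundary of `G` near `x`: `∂^vis_{x,c} G = ∂G ∩ ∂G_{x,c}`. -/
def visualBoundary (n : ℕ) (c : ℝ) (G : Set (Euc n)) (x : Euc n) : Set (Euc n) :=
  frontier G ∩ frontier (johnPart n c G x)

/-- `G` is a uniform domain with constant `C`. -/
def IsUniformDomain (n : ℕ) (C : ℝ) (G : Set (Euc n)) : Prop :=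
  IsOpen G ∧ IsConnected G ∧
  ∀ x ∈ G, ∀ y ∈ G, ∃ ℓ : ℝ, 0 ≤ ℓ ∧ ℓ ≤ C * dist x y ∧
    ∃ γ : ℝ → Euc n, LipschitzOnWith 1 γ (Set.Icc 0 ℓ) ∧ γ 0 = x ∧ γ ℓ = y ∧
      ∀ t ∈ Set.Icc 0 ℓ, γ t ∈ G ∧
        min (dist (γ t) x) (dist (γ t) y) / C ≤ Metric.infDist (γ t) (frontier G)

/-- The closed axis-parallel cube with center `z` and side length `ℓ`. -/
def cube (n : ℕ) (z : Euc n) (ℓ : ℝ) : Set (Euc n) := {y | ∀ i, |y i - z i| ≤ ℓ / 2}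

/-- Distance between two sets. -/
def setSetDist (n : ℕ) (A B : Set (Euc n)) : ℝ := sInf (Set.image2 dist A B)

/-- `Q = cube z ℓ` is a Whitney cube of the open set `G`:
`Q ⊆ G` and `diam Q ≤ dist(Q, ∂G) ≤ 4 diam Q`. -/
def IsWhitneyCube (n : ℕ) (G : Set (Euc n)) (z : Euc n) (ℓ : ℝ) : Prop :=
  0 < ℓ ∧ cube n z ℓ ⊆ G ∧
    Metric.diam (cube n z ℓ) ≤ setSetDist n (cube n z ℓ) (frontier G) ∧
    setSetDist n (cube n z ℓ) (frontier G) ≤ 4 * Metric.diam (cube n z ℓ)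

/-- The `p`-th power of the Gagliardo `(s,p)`-seminorm of `u` on `A`:
`|u|_{W^{s,p}(A)}^p = ∫_A ∫_A |u(x)-u(y)|^p |x-y|^{-(n+sp)} dy dx`. -/
def gagliardoP (n : ℕ) (s p : ℝ) (A : Set (Euc n)) (u : Euc n → ℝ) : ℝ≥0∞ :=
  ∫⁻ x in A, ∫⁻ y in A, ENNReal.ofReal (|u x - u y| ^ p / dist x y ^ ((n : ℝ) + s * p))

/-- `E` is an Ahlfors `λ`-regular set: `E` is closed and
`C⁻¹ r^λ ≤ H^λ(B(x,r) ∩ E) ≤ C r^λ` for `x ∈ E`, `0 < r < diam E`. -/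
def AhlforsRegular (n : ℕ) (lam : ℝ) (E : Set (Euc n)) : Prop :=
  IsClosed E ∧ ∃ C : ℝ, 1 < C ∧ ∀ x ∈ E, ∀ r : ℝ, 0 < r →
    ENNReal.ofReal r < EMetric.diam E →
      ENNReal.ofReal (C⁻¹ * r ^ lam) ≤ μH[lam] (Metric.ball x r ∩ E) ∧
      μH[lam] (Metric.ball x r ∩ E) ≤ ENNReal.ofReal (C * r ^ lam)

namespace FracHardy

theorem lintegral_radial_le {n : ℕ} (hn : 1 ≤ n) {a b m A A' : ℝ} (ha : 0 < a) (hb : 0 < b)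
    (hm : 0 < m) (hA : 0 ≤ A) (hA' : 0 ≤ A') (y : Euc n) (F : Euc n → ℝ≥0∞)
    (h1 : ∀ x, dist x y ≤ m → F x ≤ ENNReal.ofReal (A * dist x y ^ (a - n)))
    (h2 : ∀ x, m < dist x y → F x ≤ ENNReal.ofReal (A' * dist x y ^ (-b - n))) :
    ∫⁻ x, F x ≤ ENNReal.ofReal
      (n * volume.real (ball (0 : Euc n) 1) * (A * m ^ a / a + A' * m ^ (-b) / b)) := by
  have : Nonempty (Fin n) := ⟨⟨0, hn⟩⟩
  set Φ : ℝ → ℝ := fun r => if r ≤ m then A * r ^ (a - n) else A' * r ^ (-b - n) with hΦ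
  have hpow : ∀ r : ℝ, 0 < r → ∀ e : ℝ, r ^ (n - 1) * r ^ (e - n) = r ^ (e - 1) := by
    intro r hr e
    rw [← Real.rpow_natCast, ← Real.rpow_add hr]
    congr 1
    push_cast [hn]
    ring
  have e1 : EqOn (fun r : ℝ => r ^ (n - 1) • Φ r) (fun r => A * r ^ (a - 1)) (Ioc 0 m) := by
    intro r hr
    simp only [hΦ, if_pos hr.2, smul_eq_mul]
    rw [← hpow r hr.1 a]; ring
  have e2 : EqOn (fun r : ℝ => r ^ (n - 1) • Φ r) (fun r => A' * r ^ (-b - 1)) (Ioi m) := by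
    intro r hr
    simp only [hΦ, if_neg (not_le.2 (mem_Ioi.1 hr)), smul_eq_mul]
    rw [← hpow r (hm.trans hr) (-b)]; ring
  have i1 : IntegrableOn (fun r : ℝ => r ^ (n - 1) • Φ r) (Ioc 0 m) := by
    rw [integrableOn_congr_fun e1 measurableSet_Ioc]
    have := (intervalIntegral.intervalIntegrable_rpow' (a := 0) (b := m) (r := a - 1)
      (by linarith)).const_mul A
    exact (intervalIntegrable_iff_integrableOn_Ioc_of_le hm.le).1 this
  have i2 : IntegrableOn (fun r : ℝ => r ^ (n - 1) • Φ r) (Ioi m) := by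
    rw [integrableOn_congr_fun e2 measurableSet_Ioi]
    exact (integrableOn_Ioi_rpow_of_lt (by linarith) hm).const_mul A'
  have hu : Ioc 0 m ∪ Ioi m = Ioi (0 : ℝ) := Ioc_union_Ioi_eq_Ioi hm.le
  have hInt : Integrable (fun x : Euc n => Φ ‖x‖) := by
    rw [integrable_fun_norm_addHaar, finrank_euclideanSpace_fin, ← hu]
    exact i1.union i2
  have hval : ∫ x : Euc n, Φ ‖x‖ =
      n * volume.real (ball (0 : Euc n) 1) * (A * m ^ a / a + A' * m ^ (-b) / b) := by
    rw [integral_fun_norm_addHaar, finrank_euclideanSpace_fin, ← hu,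
      setIntegral_union (Ioc_disjoint_Ioi le_rfl) measurableSet_Ioi i1 i2,
      setIntegral_congr_fun measurableSet_Ioc e1, setIntegral_congr_fun measurableSet_Ioi e2,
      integral_const_mul, integral_const_mul, integral_Ioi_rpow_of_lt (by linarith) hm,
      ← intervalIntegral.integral_of_le hm.le, integral_rpow (Or.inl (by linarith))]
    simp only [sub_add_cancel, Real.zero_rpow ha.ne', nsmul_eq_mul, smul_eq_mul]
    field_simp
    ring
  have hΦ0 : ∀ r, 0 ≤ r → 0 ≤ Φ r := by
    intro r hr
    simp only [hΦ]; split_ifs <;> positivity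
  calc ∫⁻ x, F x ≤ ∫⁻ x, ENNReal.ofReal (Φ ‖x - y‖) := by
        refine lintegral_mono fun x => ?_
        rw [← dist_eq_norm]
        simp only [hΦ]
        split_ifs with h
        · exact h1 x h
        · exact h2 x (not_le.1 h)
    _ = ∫⁻ x : Euc n, ENNReal.ofReal (Φ ‖x‖) :=
        lintegral_sub_right_eq_self (fun x : Euc n => ENNReal.ofReal (Φ ‖x‖)) y
    _ = _ := by
        rw [← ofReal_integral_eq_lintegral_ofReal hInt
          (Filter.Eventually.of_forall fun x => hΦ0 _ (norm_nonneg _)), hval]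

/-- The Gagliardo integrand of `v`. -/
def gagliardoKernel (n : ℕ) (s p : ℝ) (v : Euc n → ℝ) (x y : Euc n) : ℝ≥0∞ :=
  ENNReal.ofReal (|v x - v y| ^ p / dist x y ^ ((n : ℝ) + s * p))

theorem measurable_gagliardoKernel {n : ℕ} {s p : ℝ} {v : Euc n → ℝ} (hv : Measurable v) :
    Measurable (Function.uncurry (gagliardoKernel n s p v)) := by
  unfold gagliardoKernel Function.uncurry
  have h1 : Measurable fun q : Euc n × Euc n => v q.1 := hv.comp measurable_fst
  have h2 : Measurable fun q : Euc n × Euc n => v q.2 := hv.comp measurable_snd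
  have h3 : Measurable fun q : Euc n × Euc n => |v q.1 - v q.2| := by
    simpa [Real.norm_eq_abs] using (h1.sub h2).norm
  have h4 : Measurable fun q : Euc n × Euc n => dist q.1 q.2 := measurable_fst.dist measurable_snd
  exact ((h3.pow_const p).div (h4.pow_const _)).ennreal_ofReal

theorem rpow_lintegral_le {α : Type*} [MeasurableSpace α] {μ : Measure α}
    [IsProbabilityMeasure μ] {p : ℝ} (hp : 1 ≤ p) {f : α → ℝ} (hf : AEStronglyMeasurable f μ) :
    (∫⁻ x, ‖f x‖ₑ ∂μ) ^ p ≤ ∫⁻ x, ‖f x‖ₑ ^ p ∂μ := by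
  have h := eLpNorm'_le_eLpNorm'_of_exponent_le (μ := μ) one_pos hp hf
  simp only [eLpNorm', ENNReal.rpow_one, one_div, inv_one] at h
  calc _ ≤ ((∫⁻ x, ‖f x‖ₑ ^ p ∂μ) ^ p⁻¹) ^ p := by gcongr
    _ = _ := by rw [← ENNReal.rpow_mul, inv_mul_cancel₀ (by positivity), ENNReal.rpow_one]

theorem enorm_sub_average_le {n : ℕ} {s p : ℝ} (hp : 1 ≤ p) (hs : 0 ≤ s)
    {v : Euc n → ℝ} (hv : Continuous v)
    {T B : Set (Euc n)} (hT : MeasurableSet T) (hTB : T ⊆ B) (h0 : volume T ≠ 0)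
    (hb : Bornology.IsBounded T) {y : Euc n} {D : ℝ} (hd : ∀ z ∈ T, dist y z ≤ D) :
    ‖v y - ⨍ z in T, v z‖ₑ ^ p ≤
      (volume T)⁻¹ * (ENNReal.ofReal (D ^ ((n : ℝ) + s * p)) *
        ∫⁻ z in B, gagliardoKernel n s p v y z) := by
  have hfin : volume T ≠ ∞ := hb.measure_lt_top.ne
  have hTi : IntegrableOn v T := by
    obtain ⟨r, hr⟩ := hb.subset_closedBall 0
    exact (hv.continuousOn.integrableOn_compact (isCompact_closedBall 0 r)).mono_set hr
  set μ := (volume.restrict T univ)⁻¹ • volume.restrict T with hμ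
  have hne : NeZero (volume.restrict T) := ⟨by simpa using h0⟩
  have hf : IsFiniteMeasure (volume.restrict T) := ⟨by simpa using hfin.lt_top⟩
  have hprob : IsProbabilityMeasure μ := isProbabilityMeasureSMul
  have hvi : Integrable v μ := hTi.smul_measure (by simpa using h0)
  have e : v y - ⨍ z in T, v z = ∫ z, (v y - v z) ∂μ := by
    rw [integral_sub (integrable_const _) hvi, integral_const, probReal_univ, one_smul]
    rfl
  have hN : 0 ≤ (n : ℝ) + s * p := by positivity
  rw [e]
  calc ‖∫ z, (v y - v z) ∂μ‖ₑ ^ p ≤ (∫⁻ z, ‖v y - v z‖ₑ ∂μ) ^ p := by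
        gcongr; exact enorm_integral_le_lintegral_enorm _
    _ ≤ ∫⁻ z, ‖v y - v z‖ₑ ^ p ∂μ :=
        rpow_lintegral_le hp (by fun_prop)
    _ = (volume T)⁻¹ * ∫⁻ z in T, ‖v y - v z‖ₑ ^ p := by
        rw [hμ, lintegral_smul_measure]; simp
    _ ≤ (volume T)⁻¹ * ∫⁻ z in T, ENNReal.ofReal (D ^ ((n : ℝ) + s * p)) *
          gagliardoKernel n s p v y z := by
        gcongr 1
        refine setLIntegral_mono' hT fun z hz => ?_
        have hD : 0 ≤ D := dist_nonneg.trans (hd z hz)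
        rw [gagliardoKernel, ← ENNReal.ofReal_mul (by positivity), Real.enorm_eq_ofReal_abs,
          ENNReal.ofReal_rpow_of_nonneg (abs_nonneg _) (by linarith)]
        apply ENNReal.ofReal_le_ofReal
        rcases eq_or_ne y z with rfl | hyz
        · simp [Real.zero_rpow (by linarith : p ≠ 0)]
        · have : 0 < dist y z := dist_pos.2 hyz
          rw [mul_div_assoc', le_div_iff₀ (by positivity), mul_comm]
          gcongr
          exact hd z hz
    _ ≤ _ := by
        rw [lintegral_const_mul' _ _ ENNReal.ofReal_ne_top]
        gcongr

/-- The dyadic annulus of outer radius `r` centered at `x`. -/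
def annulus {n : ℕ} (x : Euc n) (r : ℝ) : Set (Euc n) := ball x r \ ball x (r / 2)

/-- The volume of an annulus of outer radius `1`. -/
def annulusVol (n : ℕ) : ℝ := volume.real (ball (0 : Euc n) 1) * (1 - (1 / 2) ^ n)

theorem annulusVol_pos {n : ℕ} (hn : 1 ≤ n) : 0 < annulusVol n := by
  refine mul_pos ?_ ?_
  · exact ENNReal.toReal_pos (measure_ball_pos _ _ one_pos).ne' measure_ball_lt_top.ne
  · have : ((1 : ℝ) / 2) ^ n < 1 := pow_lt_one₀ (by norm_num) (by norm_num) (by omega)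
    linarith

theorem measurableSet_annulus {n : ℕ} (x : Euc n) (r : ℝ) : MeasurableSet (annulus x r) :=
  measurableSet_ball.diff measurableSet_ball

theorem annulus_subset_ball {n : ℕ} (x : Euc n) (r : ℝ) : annulus x r ⊆ ball x r := sdiff_subset

theorem isBounded_annulus {n : ℕ} (x : Euc n) (r : ℝ) : Bornology.IsBounded (annulus x r) :=
  isBounded_ball.subset (annulus_subset_ball x r)

theorem volume_annulus {n : ℕ} (hn : 1 ≤ n) (x : Euc n) {r : ℝ} (hr : 0 < r) :
    volume (annulus x r) = ENNReal.ofReal (annulusVol n * r ^ n) := by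
  have : Nonempty (Fin n) := ⟨⟨0, hn⟩⟩
  have hb : ∀ t : ℝ, 0 < t → volume (ball x t) =
      ENNReal.ofReal (t ^ n * volume.real (ball (0 : Euc n) 1)) := by
    intro t ht
    rw [Measure.addHaar_ball volume x ht.le, finrank_euclideanSpace_fin,
      ENNReal.ofReal_mul (by positivity), Measure.real, ENNReal.ofReal_toReal measure_ball_lt_top.ne]
  rw [annulus, measure_sdiff (ball_subset_ball (by linarith)) measurableSet_ball.nullMeasurableSet
    measure_ball_lt_top.ne, hb r hr, hb (r / 2) (by linarith),
    ← ENNReal.ofReal_sub _ (by positivity)]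
  congr 1
  rw [annulusVol, div_pow, div_pow]
  ring

theorem volume_annulus_ne_zero {n : ℕ} (hn : 1 ≤ n) (x : Euc n) {r : ℝ} (hr : 0 < r) :
    volume (annulus x r) ≠ 0 := by
  rw [volume_annulus hn x hr]
  have := annulusVol_pos hn
  simpa using by positivity

/-- The constant in the comparison of a value with the average over a nearby annulus. -/
def annulusConst (n : ℕ) (s p : ℝ) : ℝ := (4 ^ ((n : ℝ) + s * p) / annulusVol n) ^ (1 / p)

theorem annulusConst_pos {n : ℕ} (hn : 1 ≤ n) (s p : ℝ) : 0 < annulusConst n s p := by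
  have := annulusVol_pos hn
  unfold annulusConst
  positivity

/-- The `L^p` averaged difference quotient of `v` at `y`, localized to `B`. -/
def fracGrad (n : ℕ) (s p : ℝ) (v : Euc n → ℝ) (B : Set (Euc n)) (y : Euc n) : ℝ≥0∞ :=
  (∫⁻ z in B, gagliardoKernel n s p v y z) ^ (1 / p)

theorem measurable_fracGrad {n : ℕ} {s p : ℝ} {v : Euc n → ℝ} (hv : Measurable v)
    (B : Set (Euc n)) : Measurable (fracGrad n s p v B) :=
  (Measurable.lintegral_prod_right (measurable_gagliardoKernel hv)).pow_const _

theorem fracGrad_rpow {n : ℕ} {s p : ℝ} (hp : 0 < p) (v : Euc n → ℝ) (B : Set (Euc n))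
    (y : Euc n) : fracGrad n s p v B y ^ p = ∫⁻ z in B, gagliardoKernel n s p v y z := by
  rw [fracGrad, ← ENNReal.rpow_mul, one_div_mul_cancel hp.ne', ENNReal.rpow_one]

theorem enorm_sub_annulus_average_le {n : ℕ} (hn : 1 ≤ n) {s p : ℝ} (hp : 1 ≤ p) (hs : 0 ≤ s)
    {v : Euc n → ℝ} (hv : Continuous v) {B : Set (Euc n)} {x y : Euc n} {r : ℝ} (hr : 0 < r)
    (hB : annulus x r ⊆ B) (hd : ∀ z ∈ annulus x r, dist y z ≤ 4 * r) :
    ‖v y - ⨍ z in annulus x r, v z‖ₑ ≤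
      ENNReal.ofReal (annulusConst n s p * r ^ s) * fracGrad n s p v B y := by
  have ha := annulusVol_pos hn
  have hp0 : 0 < p := by linarith
  have h := enorm_sub_average_le hp hs hv (measurableSet_annulus x r) hB
    (volume_annulus_ne_zero hn x hr) (isBounded_annulus x r) hd
  rw [volume_annulus hn x hr, ← mul_assoc, ← ENNReal.ofReal_inv_of_pos (by positivity),
    ← ENNReal.ofReal_mul (by positivity)] at h
  have h' := ENNReal.rpow_le_rpow h (by positivity : 0 ≤ 1 / p)
  rw [← ENNReal.rpow_mul, mul_one_div_cancel hp0.ne', ENNReal.rpow_one,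
    ENNReal.mul_rpow_of_nonneg _ _ (by positivity),
    ENNReal.ofReal_rpow_of_nonneg (by positivity) (by positivity)] at h'
  refine h'.trans_eq ?_
  rw [fracGrad]
  congr 2
  have e : (annulusVol n * r ^ n)⁻¹ * (4 * r) ^ ((n : ℝ) + s * p) =
      (4 ^ ((n : ℝ) + s * p) / annulusVol n) * (r ^ s) ^ p := by
    rw [Real.mul_rpow (by norm_num) hr.le, Real.rpow_add hr, Real.rpow_natCast,
      Real.rpow_mul hr.le]
    field_simp
  rw [e, Real.mul_rpow (by positivity) (by positivity), annulusConst,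
    ← Real.rpow_mul (by positivity : 0 ≤ r ^ s), mul_one_div_cancel hp0.ne', Real.rpow_one]

theorem enorm_annulus_average_sub_le {n : ℕ} (hn : 1 ≤ n) {s p : ℝ} (hp : 1 ≤ p) (hs : 0 ≤ s)
    (hsn : s ≤ n) {v : Euc n → ℝ} (hv : Continuous v) {B : Set (Euc n)} {x : Euc n} {r : ℝ}
    (hr : 0 < r) (hB : ball x r ⊆ B) :
    ‖(⨍ z in annulus x r, v z) - ⨍ z in annulus x (r / 2), v z‖ₑ ≤
      ENNReal.ofReal (annulusConst n s p / annulusVol n) *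
        ∫⁻ y in annulus x r, fracGrad n s p v B y * ENNReal.ofReal (dist x y ^ (s - (n : ℝ))) := by
  have ha := annulusVol_pos hn
  have hc := annulusConst_pos hn s p
  set S := annulus x r with hS
  set b := ⨍ z in annulus x (r / 2), v z with hb
  set μ := (volume.restrict S univ)⁻¹ • volume.restrict S with hμ
  have h0 : volume S ≠ 0 := volume_annulus_ne_zero hn x hr
  have hfin : volume S ≠ ∞ := (isBounded_annulus x r).measure_lt_top.ne
  have hne : NeZero (volume.restrict S) := ⟨by simpa using h0⟩
  have hf : IsFiniteMeasure (volume.restrict S) := ⟨by simpa using hfin.lt_top⟩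
  have hprob : IsProbabilityMeasure μ := isProbabilityMeasureSMul
  have hSi : IntegrableOn v S :=
    (hv.continuousOn.integrableOn_compact (isCompact_closedBall x r)).mono_set
      ((annulus_subset_ball x r).trans ball_subset_closedBall)
  have hvi : Integrable v μ := hSi.smul_measure (by simpa using h0)
  have e : (⨍ z in S, v z) - b = ∫ z, (v z - b) ∂μ := by
    rw [integral_sub hvi (integrable_const _), integral_const, probReal_univ, one_smul]
    rfl
  rw [e]
  calc ‖∫ z, (v z - b) ∂μ‖ₑ ≤ ∫⁻ z, ‖v z - b‖ₑ ∂μ := enorm_integral_le_lintegral_enorm _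
    _ = (volume S)⁻¹ * ∫⁻ z in S, ‖v z - b‖ₑ := by
        rw [hμ, lintegral_smul_measure]; simp
    _ ≤ ENNReal.ofReal ((annulusVol n * r ^ n)⁻¹) *
          ∫⁻ y in S, ENNReal.ofReal (annulusConst n s p * r ^ s) * fracGrad n s p v B y := by
        rw [volume_annulus hn x hr, ← ENNReal.ofReal_inv_of_pos (by positivity)]
        gcongr 1
        refine setLIntegral_mono' (measurableSet_annulus x r) fun y hy => ?_
        refine (enorm_sub_annulus_average_le hn hp hs hv (half_pos hr) (B := B)
          ((annulus_subset_ball x _).trans ((ball_subset_ball (by linarith)).trans hB)) ?_).trans ?_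
        · intro z hz
          have h1 : dist y x < r := annulus_subset_ball x r hy
          have h2 : dist z x < r / 2 := annulus_subset_ball x _ hz
          have := dist_triangle_right y z x
          linarith
        · gcongr
          linarith
    _ = ENNReal.ofReal (annulusConst n s p / annulusVol n) *
          ∫⁻ y in S, fracGrad n s p v B y * ENNReal.ofReal (r ^ (s - (n : ℝ))) := by
        rw [lintegral_const_mul' _ _ ENNReal.ofReal_ne_top,
          lintegral_mul_const' _ _ ENNReal.ofReal_ne_top, ← mul_assoc,
          ← ENNReal.ofReal_mul (by positivity), mul_comm (∫⁻ y in S, _),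
          ← mul_assoc (ENNReal.ofReal (annulusConst n s p / annulusVol n)), ← ENNReal.ofReal_mul (by positivity)]
        congr 2
        rw [Real.rpow_sub hr, Real.rpow_natCast]
        field_simp
    _ ≤ _ := by
        gcongr 1
        refine setLIntegral_mono' (measurableSet_annulus x r) fun y hy => ?_
        gcongr 1
        apply ENNReal.ofReal_le_ofReal
        have h1 : dist x y < r := by rw [dist_comm]; exact hy.1
        have h2 : r / 2 ≤ dist x y := by rw [dist_comm]; simpa using hy.2
        exact Real.rpow_le_rpow_of_nonpos (by linarith) h1.le (by linarith)

theorem tendsto_annulus_average {n : ℕ} (hn : 1 ≤ n) {v : Euc n → ℝ} (hv : Continuous v)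
    (x : Euc n) {R : ℝ} (hR : 0 < R) :
    Filter.Tendsto (fun k : ℕ => ⨍ z in annulus x (R / 2 ^ k), v z) Filter.atTop (𝓝 (v x)) := by
  rw [Metric.tendsto_atTop]
  intro ε hε
  obtain ⟨δ, hδ, hvδ⟩ := Metric.continuous_iff.1 hv x (ε / 2) (half_pos hε)
  obtain ⟨K, hK⟩ := exists_pow_lt_of_lt_one (div_pos hδ hR) (by norm_num : (1 / 2 : ℝ) < 1)
  refine ⟨K, fun k hk => ?_⟩
  have hr : 0 < R / 2 ^ k := by positivity
  have hrδ : R / 2 ^ k < δ := by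
    have h1 : (1 / 2 : ℝ) ^ k ≤ (1 / 2) ^ K := pow_le_pow_of_le_one (by norm_num) (by norm_num) hk
    have h2 : (1 / 2 : ℝ) ^ k < δ / R := h1.trans_lt hK
    rw [lt_div_iff₀ hR] at h2
    calc R / 2 ^ k = (1 / 2) ^ k * R := by rw [one_div, inv_pow]; field_simp
      _ < δ := h2
  have hmem : (⨍ z in annulus x (R / 2 ^ k), v z) ∈ closedBall (v x) (ε / 2) := by
    refine (convex_closedBall (v x) (ε / 2)).set_average_mem isClosed_closedBall
      (volume_annulus_ne_zero hn x hr) (isBounded_annulus x _).measure_lt_top.ne ?_ ?_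
    · refine (ae_restrict_iff' (measurableSet_annulus x _)).2 (Filter.Eventually.of_forall ?_)
      intro z hz
      exact (hvδ z ((mem_ball.1 (annulus_subset_ball x _ hz)).trans hrδ)).le
    · exact (hv.continuousOn.integrableOn_compact (isCompact_closedBall x (R / 2 ^ k))).mono_set
        ((annulus_subset_ball x _).trans ball_subset_closedBall)
  exact lt_of_le_of_lt hmem (by linarith)

theorem enorm_sub_le_potential {n : ℕ} (hn : 1 ≤ n) {s p : ℝ} (hp : 1 ≤ p) (hs : 0 ≤ s)
    (hsn : s ≤ n) {v : Euc n → ℝ} (hv : Continuous v) {B : Set (Euc n)}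
    {x w : Euc n} {R : ℝ} (hR : 0 < R) (hB : ball x R ⊆ B) (hw : ∀ z ∈ ball x R, dist w z ≤ 4 * R) :
    ‖v w - v x‖ₑ ≤ ENNReal.ofReal (annulusConst n s p * R ^ s) * fracGrad n s p v B w +
      ENNReal.ofReal (annulusConst n s p / annulusVol n) *
        ∫⁻ y in B, fracGrad n s p v B y * ENNReal.ofReal (dist x y ^ (s - (n : ℝ))) := by
  set b : ℕ → ℝ := fun k => ⨍ z in annulus x (R / 2 ^ k), v z with hb
  set h : Euc n → ℝ≥0∞ := fun y =>
    fracGrad n s p v B y * ENNReal.ofReal (dist x y ^ (s - (n : ℝ))) with hh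
  set C := ENNReal.ofReal (annulusConst n s p / annulusVol n) with hC
  have hmono : ∀ k : ℕ, R / 2 ^ k ≤ R := fun k =>
    div_le_self hR.le (one_le_pow₀ (by norm_num))
  have hstep : ∀ k, ‖b k - b (k + 1)‖ₑ ≤ C * ∫⁻ y in annulus x (R / 2 ^ k), h y := by
    intro k
    have := enorm_annulus_average_sub_le hn hp hs hsn hv (B := B) (x := x) (r := R / 2 ^ k)
      (by positivity) ((ball_subset_ball (hmono k)).trans hB)
    rwa [div_div, ← pow_succ] at this
  have hdisj : Pairwise (Function.onFun Disjoint fun k : ℕ => annulus x (R / 2 ^ k)) := by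
    rw [pairwise_disjoint_on]
    intro i j hij
    rw [Set.disjoint_left]
    intro y hy hy'
    refine hy.2 (ball_subset_ball ?_ (annulus_subset_ball x _ hy'))
    rw [div_div, ← pow_succ]
    gcongr
    · norm_num
    · exact hij
  have hsum : ∀ K : ℕ, ‖b 0 - b K‖ₑ ≤ C * ∑ k ∈ Finset.range K,
      ∫⁻ y in annulus x (R / 2 ^ k), h y := by
    intro K
    induction K with
    | zero => simp
    | succ K ih =>
      rw [Finset.sum_range_succ, mul_add]
      calc ‖b 0 - b (K + 1)‖ₑ = ‖(b 0 - b K) + (b K - b (K + 1))‖ₑ := by ring_nf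
        _ ≤ ‖b 0 - b K‖ₑ + ‖b K - b (K + 1)‖ₑ := enorm_add_le _ _
        _ ≤ _ := add_le_add ih (hstep K)
  have hsum' : ∀ K : ℕ, ‖b 0 - b K‖ₑ ≤ C * ∫⁻ y in B, h y := by
    intro K
    refine (hsum K).trans ?_
    gcongr 1
    calc _ ≤ ∑' k : ℕ, ∫⁻ y in annulus x (R / 2 ^ k), h y := ENNReal.sum_le_tsum _
      _ = ∫⁻ y in ⋃ k : ℕ, annulus x (R / 2 ^ k), h y :=
          (lintegral_iUnion (fun k => measurableSet_annulus x _) hdisj h).symm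
      _ ≤ _ := lintegral_mono_set (iUnion_subset fun k =>
          (annulus_subset_ball x _).trans ((ball_subset_ball (hmono k)).trans hB))
  have h0 : ‖v w - b 0‖ₑ ≤
      ENNReal.ofReal (annulusConst n s p * R ^ s) * fracGrad n s p v B w := by
    have := enorm_sub_annulus_average_le hn hp hs hv (B := B) (x := x) (y := w) hR
      ((annulus_subset_ball x R).trans hB) fun z hz => hw z (annulus_subset_ball x R hz)
    simpa [hb] using this
  have hK : ∀ K : ℕ, ‖v w - b K‖ₑ ≤
      ENNReal.ofReal (annulusConst n s p * R ^ s) * fracGrad n s p v B w + C * ∫⁻ y in B, h y := by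
    intro K
    calc ‖v w - b K‖ₑ = ‖(v w - b 0) + (b 0 - b K)‖ₑ := by ring_nf
      _ ≤ ‖v w - b 0‖ₑ + ‖b 0 - b K‖ₑ := enorm_add_le _ _
      _ ≤ _ := add_le_add h0 (hsum' K)
  have hlim : Filter.Tendsto (fun K => ‖v w - b K‖ₑ) Filter.atTop (𝓝 ‖v w - v x‖ₑ) :=
    (continuous_enorm.tendsto _).comp
      (tendsto_const_nhds.sub (tendsto_annulus_average hn hv x hR))
  exact le_of_tendsto' hlim hK

/-- The constant in the local Maz'ya type estimate. -/
def mazyaConst (n : ℕ) (s p σ : ℝ) : ℝ :=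
  (2 * annulusConst n s p) ^ p + (2 * annulusConst n s p / annulusVol n) ^ p / σ

theorem mazyaConst_pos {n : ℕ} (hn : 1 ≤ n) (s p : ℝ) {σ : ℝ} (hσ : 0 < σ) :
    0 < mazyaConst n s p σ := by
  have := annulusVol_pos hn
  have := annulusConst_pos hn s p
  unfold mazyaConst
  positivity

theorem ofReal_rpow_le_of_fat {n : ℕ} (hn : 1 ≤ n) {s p σ : ℝ} (hp : 1 ≤ p) (hs : 0 ≤ s)
    (hsn : s ≤ n) (hσ : 0 < σ) {v : Euc n → ℝ} (hv : Continuous v) {Z : Set (Euc n)}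
    (hvZ : ∀ x ∈ Z, v x = 0) {z w : Euc n} {R : ℝ} (hR : 0 < R) (hzw : dist w z ≤ R)
    (hfat : ENNReal.ofReal (σ * R ^ ((n : ℝ) - s * p)) ≤ rieszCap n s p (ball z R ∩ Z)) :
    ENNReal.ofReal (|v w| ^ p) ≤ ENNReal.ofReal (mazyaConst n s p σ * R ^ (s * p)) *
      ((∫⁻ y in ball w (3 * R), gagliardoKernel n s p v w y) + ENNReal.ofReal (R ^ (-(n : ℝ))) *
        ∫⁻ x in ball w (3 * R), ∫⁻ y in ball w (3 * R), gagliardoKernel n s p v x y) := by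
  have ha := annulusVol_pos hn
  have hc := annulusConst_pos hn s p
  have hM := mazyaConst_pos hn s p hσ
  have hp0 : 0 < p := by linarith
  set c := annulusConst n s p with hcdef
  set a := annulusVol n with hadef
  set B := ball w (3 * R) with hB
  set I := ∫⁻ x in B, ∫⁻ y in B, gagliardoKernel n s p v x y with hI
  set t := |v w| with ht
  have ht0 : 0 ≤ t := abs_nonneg _
  rcases ht0.eq_or_lt with h0 | htpos
  · rw [← h0, Real.zero_rpow hp0.ne']; simp
  by_cases hItop : I = ∞
  · rw [hItop, ENNReal.mul_top (by simpa using by positivity), add_top,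
      ENNReal.mul_top (by simpa using by positivity)]
    exact le_top
  have hg : Measurable (fracGrad n s p v B) := measurable_fracGrad hv.measurable B
  have hgI : ∫⁻ y in B, fracGrad n s p v B y ^ p = I := by
    simp_rw [fracGrad_rpow hp0]; rfl
  rcases le_or_gt (ENNReal.ofReal (t / 2)) (ENNReal.ofReal (c * R ^ s) * fracGrad n s p v B w)
    with h1 | h1
  · have h2 := ENNReal.rpow_le_rpow h1 hp0.le
    rw [ENNReal.mul_rpow_of_nonneg _ _ hp0.le, fracGrad_rpow hp0,
      ENNReal.ofReal_rpow_of_nonneg (by positivity) hp0.le,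
      ENNReal.ofReal_rpow_of_nonneg (by positivity) hp0.le] at h2
    have e : t ^ p = 2 ^ p * (t / 2) ^ p := by
      rw [← Real.mul_rpow (by norm_num) (by positivity)]; congr 1; ring
    rw [e, ENNReal.ofReal_mul (by positivity)]
    calc _ ≤ ENNReal.ofReal (2 ^ p) * (ENNReal.ofReal ((c * R ^ s) ^ p) *
          ∫⁻ y in B, gagliardoKernel n s p v w y) := by gcongr
      _ = ENNReal.ofReal ((2 * c) ^ p * R ^ (s * p)) *
          ∫⁻ y in B, gagliardoKernel n s p v w y := by
          rw [← mul_assoc, ← ENNReal.ofReal_mul (by positivity),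
            Real.mul_rpow hc.le (by positivity), Real.mul_rpow (by norm_num) hc.le,
            ← Real.rpow_mul hR.le, mul_assoc]
      _ ≤ _ := by
          gcongr
          · rw [mazyaConst]
            have : 0 ≤ (2 * c / a) ^ p / σ := by positivity
            linarith
          · exact le_self_add
  · have hpot : ∀ x ∈ ball z R ∩ Z, ENNReal.ofReal (t / 2) ≤ ENNReal.ofReal (c / a) *
        ∫⁻ y in B, fracGrad n s p v B y * ENNReal.ofReal (dist x y ^ (s - (n : ℝ))) := by
      intro x hx
      have hxz : dist x z < R := hx.1
      have hxw : dist w x < 2 * R := by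
        have := dist_triangle_right w x z
        linarith
      have h2 := enorm_sub_le_potential hn hp hs hsn hv (B := B) (x := x) (w := w) hR
        (by
          apply ball_subset_ball'
          rw [dist_comm]; linarith)
        (by
          intro y hy
          have h3 : dist y x < R := hy
          have := dist_triangle_right w y x
          linarith)
      rw [hvZ x hx.2, sub_zero, Real.enorm_eq_ofReal_abs, ← ht] at h2
      by_contra hlt
      rw [not_le] at hlt
      have h3 := ENNReal.add_lt_add h1 hlt
      rw [← ENNReal.ofReal_add (by positivity) (by positivity), add_halves] at h3
      exact absurd h2 (not_le.2 h3)
    set q := 2 * c / a / t with hq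
    have hq0 : 0 < q := by positivity
    have hgfin : ∀ᵐ y ∂(volume.restrict B), fracGrad n s p v B y < ∞ := by
      have := ae_lt_top (hg.pow_const p) (by rw [hgI]; exact hItop)
      filter_upwards [this] with y hy
      by_contra hne
      rw [not_lt, top_le_iff] at hne
      simp [hne, ENNReal.top_rpow_of_pos hp0] at hy
    set f : Euc n → ℝ := B.indicator fun y => q * (fracGrad n s p v B y).toReal with hf
    have hfm : Measurable f := (hg.ennreal_toReal.const_mul q).indicator measurableSet_ball
    have hf0 : ∀ y, 0 ≤ f y := fun y => indicator_nonneg (fun _ _ => by positivity) y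
    have hfe : ∀ᵐ y ∂(volume.restrict B),
        ENNReal.ofReal (f y) = ENNReal.ofReal q * fracGrad n s p v B y := by
      filter_upwards [hgfin, ae_restrict_mem measurableSet_ball] with y hy hyB
      rw [hf, indicator_of_mem hyB, ENNReal.ofReal_mul hq0.le, ENNReal.ofReal_toReal hy.ne]
    have hadm : ∀ x ∈ ball z R ∩ Z,
        1 ≤ ∫⁻ y, ENNReal.ofReal (f y) * ENNReal.ofReal (dist x y ^ (s - (n : ℝ))) := by
      intro x hx
      calc (1 : ℝ≥0∞) = ENNReal.ofReal (2 / t) * ENNReal.ofReal (t / 2) := by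
            rw [← ENNReal.ofReal_mul (by positivity)]
            rw [div_mul_div_comm, mul_comm, div_self (by positivity), ENNReal.ofReal_one]
        _ ≤ ENNReal.ofReal (2 / t) * (ENNReal.ofReal (c / a) * ∫⁻ y in B,
            fracGrad n s p v B y * ENNReal.ofReal (dist x y ^ (s - (n : ℝ)))) := by
            gcongr; exact hpot x hx
        _ = ENNReal.ofReal q * ∫⁻ y in B,
            fracGrad n s p v B y * ENNReal.ofReal (dist x y ^ (s - (n : ℝ))) := by
            rw [← mul_assoc, ← ENNReal.ofReal_mul (by positivity)]
            congr 2
            rw [hq]; field_simp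
        _ = ∫⁻ y in B, ENNReal.ofReal (f y) * ENNReal.ofReal (dist x y ^ (s - (n : ℝ))) := by
            rw [← lintegral_const_mul' _ _ ENNReal.ofReal_ne_top]
            refine lintegral_congr_ae ?_
            filter_upwards [hfe] with y hy
            rw [hy, mul_assoc]
        _ ≤ _ := setLIntegral_le_lintegral _ _
    have hcap : rieszCap n s p (ball z R ∩ Z) ≤ ∫⁻ x, ENNReal.ofReal (f x ^ p) :=
      iInf_le_of_le f (iInf_le_of_le hfm (iInf_le_of_le hf0 (iInf_le _ hadm)))
    have hfI : ∫⁻ x, ENNReal.ofReal (f x ^ p) = ENNReal.ofReal (q ^ p) * I := by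
      have e1 : ∫⁻ x, ENNReal.ofReal (f x ^ p) = ∫⁻ x in B, ENNReal.ofReal (f x ^ p) := by
        rw [← lintegral_indicator measurableSet_ball]
        congr 1 with x
        by_cases hx : x ∈ B
        · rw [indicator_of_mem hx]
        · rw [indicator_of_notMem hx, hf, indicator_of_notMem hx, Real.zero_rpow hp0.ne',
            ENNReal.ofReal_zero]
      rw [e1, ← hgI, ← lintegral_const_mul' _ _ ENNReal.ofReal_ne_top]
      refine lintegral_congr_ae ?_
      filter_upwards [hfe] with y hy
      rw [← ENNReal.ofReal_rpow_of_nonneg (hf0 y) hp0.le, hy,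
        ENNReal.mul_rpow_of_nonneg _ _ hp0.le, ENNReal.ofReal_rpow_of_nonneg hq0.le hp0.le]
    have hmain := hfat.trans (hcap.trans_eq hfI)
    calc ENNReal.ofReal (t ^ p)
        = ENNReal.ofReal (t ^ p * (σ * R ^ ((n : ℝ) - s * p))⁻¹) *
          ENNReal.ofReal (σ * R ^ ((n : ℝ) - s * p)) := by
          rw [← ENNReal.ofReal_mul (by positivity), mul_assoc, inv_mul_cancel₀ (by positivity),
            mul_one]
      _ ≤ ENNReal.ofReal (t ^ p * (σ * R ^ ((n : ℝ) - s * p))⁻¹) *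
          (ENNReal.ofReal (q ^ p) * I) := by gcongr
      _ = ENNReal.ofReal ((2 * c / a) ^ p / σ * R ^ (s * p)) *
          (ENNReal.ofReal (R ^ (-(n : ℝ))) * I) := by
          rw [← mul_assoc, ← mul_assoc, ← ENNReal.ofReal_mul (by positivity),
            ← ENNReal.ofReal_mul (by positivity)]
          congr 2
          rw [hq, Real.div_rpow (by positivity) ht0, Real.rpow_sub hR, Real.rpow_neg hR.le]
          field_simp
      _ ≤ _ := by
          gcongr
          · rw [mazyaConst]
            have : 0 ≤ (2 * c) ^ p := by positivity
            linarith
          · exact le_add_self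

theorem lintegral_max_rpow_le {n : ℕ} (hn : 1 ≤ n) {β m : ℝ} (hβ : 0 < β) (hβ1 : β ≤ 1)
    (hm : 0 < m) (x : Euc n) :
    ∫⁻ w, ENNReal.ofReal (max m (dist w x) ^ (-(n + β))) ≤
      ENNReal.ofReal (2 * n * volume.real (ball (0 : Euc n) 1) / β * m ^ (-β)) := by
  have hn0 : (1 : ℝ) ≤ n := by exact_mod_cast hn
  refine (lintegral_radial_le hn (a := n) (b := β) (m := m) (A := m ^ (-(n + β))) (A' := 1)
    (by linarith) hβ hm (by positivity) zero_le_one x _ ?_ ?_).trans ?_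
  · intro w hw
    rw [max_eq_left hw, sub_self, Real.rpow_zero, mul_one]
  · intro w hw
    rw [max_eq_right hw.le, one_mul]
    ring_nf
    exact le_rfl
  · apply ENNReal.ofReal_le_ofReal
    have e : m ^ (-(n + β)) * m ^ (n : ℝ) = m ^ (-β) := by
      rw [← Real.rpow_add hm]; congr 1; ring
    rw [e, one_mul]
    have h1 : m ^ (-β) / n ≤ m ^ (-β) / β := by
      gcongr; linarith
    calc _ ≤ n * volume.real (ball (0 : Euc n) 1) * (m ^ (-β) / β + m ^ (-β) / β) := by gcongr
      _ = _ := by ring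

/-- The constant in the weighted estimate. -/
def weightConst (n : ℕ) (s p σ : ℝ) : ℝ :=
  mazyaConst n s p σ * (4 + 4 ^ (n + 1) * (2 * n * volume.real (ball (0 : Euc n) 1)))

theorem weightConst_pos {n : ℕ} (hn : 1 ≤ n) (s p : ℝ) {σ : ℝ} (hσ : 0 < σ) :
    0 < weightConst n s p σ := by
  have := mazyaConst_pos hn s p hσ
  unfold weightConst
  positivity

theorem gagliardoKernel_mul_rpow_neg_le {n : ℕ} {s p : ℝ} (hp : 0 < p) {v : Euc n → ℝ}
    {d : Euc n → ℝ} (hd0 : ∀ x, 0 ≤ d x) (hvd : ∀ x, d x = 0 → v x = 0) {x y : Euc n} {r e : ℝ}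
    (he : 0 ≤ e) {m : ℝ} (hm : max (d x) (d y) ≤ m) (hmr : m ≤ 4 * r) :
    gagliardoKernel n s p v x y * ENNReal.ofReal (r ^ (-e)) ≤
      gagliardoKernel n s p v x y * ENNReal.ofReal (4 ^ e * m ^ (-e)) := by
  have hmax : 0 ≤ max (d x) (d y) := (hd0 x).trans (le_max_left _ _)
  rcases (hmax.trans hm).eq_or_lt with h | h
  · have hx : d x = 0 := le_antisymm ((le_max_left _ _).trans (hm.trans h.ge)) (hd0 x)
    have hy : d y = 0 := le_antisymm ((le_max_right _ _).trans (hm.trans h.ge)) (hd0 y)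
    simp [gagliardoKernel, hvd x hx, hvd y hy, Real.zero_rpow hp.ne']
  · gcongr
    have : (m / 4) ^ (-e) = 4 ^ e * m ^ (-e) := by
      rw [Real.div_rpow h.le (by norm_num), Real.rpow_neg (by norm_num : (0 : ℝ) ≤ 4)]
      field_simp
    rw [← this]
    exact Real.rpow_le_rpow_of_nonpos (by positivity) (by linarith) (by linarith)

theorem lintegral_div_infDist_rpow_le {n : ℕ} (hn : 1 ≤ n) {s p σ β : ℝ} (hp : 1 ≤ p)
    (hs : 0 ≤ s) (hsn : s ≤ n) (hσ : 0 < σ) (hβ : 0 < β) (hβ1 : β ≤ 1) {G : Set (Euc n)}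
    (hG : IsOpen G) (hGne : Gᶜ.Nonempty)
    (hfat : ∀ x ∈ Gᶜ, ∀ r : ℝ, 0 < r →
      ENNReal.ofReal (σ * r ^ ((n : ℝ) - s * p)) ≤ rieszCap n s p (ball x r ∩ Gᶜ))
    {v : Euc n → ℝ} (hv : Continuous v) (hvG : ∀ x ∈ Gᶜ, v x = 0) :
    ∫⁻ w in G, ENNReal.ofReal (|v w| ^ p / infDist w Gᶜ ^ (s * p + β)) ≤
      ENNReal.ofReal (weightConst n s p σ / β) * ∫⁻ x, ∫⁻ y, gagliardoKernel n s p v x y *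
        ENNReal.ofReal (max (infDist x Gᶜ) (infDist y Gᶜ) ^ (-β)) := by
  have hp0 : 0 < p := by linarith
  have hM := mazyaConst_pos hn s p hσ
  set d : Euc n → ℝ := fun x => infDist x Gᶜ with hd
  have hd0 : ∀ x, 0 ≤ d x := fun x => infDist_nonneg
  have hGc : IsClosed Gᶜ := hG.isClosed_compl
  have hvd : ∀ x, d x = 0 → v x = 0 := fun x hx =>
    hvG x ((hGc.mem_iff_infDist_zero hGne).2 hx)
  have hdlip : ∀ x y, d x ≤ d y + dist x y := fun x y => infDist_le_infDist_add_dist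
  have hdm : Measurable d := (continuous_infDist_pt _).measurable
  set M := mazyaConst n s p σ with hMdef
  set ω := volume.real (ball (0 : Euc n) 1) with hω
  set K := gagliardoKernel n s p v with hK
  have hKm : Measurable fun q : Euc n × Euc n => K q.1 q.2 := measurable_gagliardoKernel hv.measurable
  set m : Euc n → Euc n → ℝ := fun x y => max (d x) (d y) with hm
  have hmm : Measurable fun q : Euc n × Euc n => m q.1 q.2 :=
    (hdm.comp measurable_fst).max (hdm.comp measurable_snd)
  set J := ∫⁻ x, ∫⁻ y, K x y * ENNReal.ofReal (m x y ^ (-β)) with hJ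
  set H : Euc n → Euc n → Euc n → ℝ≥0∞ := fun w x y => K x y *
    ENNReal.ofReal (4 ^ (n + 1) * max (m x y) (dist w x) ^ (-(n + β))) with hH
  have hn0 : (1 : ℝ) ≤ n := by exact_mod_cast hn
  have hpt : ∀ w ∈ G, ENNReal.ofReal (|v w| ^ p / d w ^ (s * p + β)) ≤
      ENNReal.ofReal M * ((ENNReal.ofReal 4 * ∫⁻ y, K w y * ENNReal.ofReal (m w y ^ (-β))) +
        ∫⁻ x, ∫⁻ y, H w x y) := by
    intro w hw
    have hdw : 0 < d w := (hGc.notMem_iff_infDist_pos hGne).1 (by simpa using hw)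
    obtain ⟨z, hz, hzw⟩ := hGc.exists_infDist_eq_dist hGne w
    have h := ofReal_rpow_le_of_fat hn hp hs hsn hσ hv hvG hdw hzw.ge (hfat z hz _ hdw)
    have hdx : ∀ x ∈ ball w (3 * d w), d x ≤ 4 * d w := by
      intro x hx
      have h1 := hdlip x w
      have h2 : dist x w < 3 * d w := hx
      linarith
    have h4 : (4 : ℝ) ^ β ≤ 4 := by
      simpa using Real.rpow_le_rpow_of_exponent_le (by norm_num : (1 : ℝ) ≤ 4) hβ1
    have h4' : (4 : ℝ) ^ (n + β) ≤ 4 ^ (n + 1) := by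
      rw [← Real.rpow_natCast]
      apply Real.rpow_le_rpow_of_exponent_le (by norm_num)
      push_cast; linarith
    have hfirst : ENNReal.ofReal (d w ^ (-β)) * ∫⁻ y in ball w (3 * d w), K w y ≤
        ENNReal.ofReal 4 * ∫⁻ y, K w y * ENNReal.ofReal (m w y ^ (-β)) := by
      rw [← lintegral_const_mul' _ _ ENNReal.ofReal_ne_top,
        ← lintegral_const_mul' _ _ ENNReal.ofReal_ne_top]
      refine (setLIntegral_mono' measurableSet_ball fun y hy => ?_).trans
        (setLIntegral_le_lintegral _ _)
      rw [mul_comm]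
      refine (gagliardoKernel_mul_rpow_neg_le hp0 hd0 hvd hβ.le (le_refl (m w y))
        (max_le (by linarith) (hdx y hy))).trans ?_
      rw [mul_left_comm, ← ENNReal.ofReal_mul (by norm_num)]
      gcongr
    have hsecond : ENNReal.ofReal (d w ^ (-(n + β))) *
        ∫⁻ x in ball w (3 * d w), ∫⁻ y in ball w (3 * d w), K x y ≤ ∫⁻ x, ∫⁻ y, H w x y := by
      rw [← lintegral_const_mul' _ _ ENNReal.ofReal_ne_top]
      refine (setLIntegral_mono' measurableSet_ball fun x hx => ?_).trans
        (setLIntegral_le_lintegral _ _)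
      rw [← lintegral_const_mul' _ _ ENNReal.ofReal_ne_top]
      refine (setLIntegral_mono' measurableSet_ball fun y hy => ?_).trans
        (setLIntegral_le_lintegral _ _)
      rw [mul_comm]
      have hxw : dist w x < 3 * d w := by rw [dist_comm]; exact hx
      refine (gagliardoKernel_mul_rpow_neg_le hp0 hd0 hvd (by positivity)
        (m := max (m x y) (dist w x)) (le_max_left _ _)
        (max_le (max_le (hdx x hx) (hdx y hy)) (by linarith))).trans ?_
      simp only [hH]
      gcongr
    calc ENNReal.ofReal (|v w| ^ p / d w ^ (s * p + β))
        = ENNReal.ofReal (d w ^ (-(s * p + β))) * ENNReal.ofReal (|v w| ^ p) := by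
          rw [← ENNReal.ofReal_mul (by positivity), Real.rpow_neg hdw.le]
          congr 1
          rw [div_eq_inv_mul]
      _ ≤ ENNReal.ofReal (d w ^ (-(s * p + β))) * (ENNReal.ofReal (M * d w ^ (s * p)) *
          ((∫⁻ y in ball w (3 * d w), K w y) + ENNReal.ofReal (d w ^ (-(n : ℝ))) *
            ∫⁻ x in ball w (3 * d w), ∫⁻ y in ball w (3 * d w), K x y)) := by
          gcongr
      _ = ENNReal.ofReal M * (ENNReal.ofReal (d w ^ (-β)) * (∫⁻ y in ball w (3 * d w), K w y) +
          ENNReal.ofReal (d w ^ (-(n + β))) *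
            ∫⁻ x in ball w (3 * d w), ∫⁻ y in ball w (3 * d w), K x y) := by
          have e1 : d w ^ (-(s * p + β)) * (M * d w ^ (s * p)) = M * d w ^ (-β) := by
            rw [mul_left_comm, ← Real.rpow_add hdw]; congr 2; ring
          have e2 : d w ^ (-(n + β)) = d w ^ (-β) * d w ^ (-(n : ℝ)) := by
            rw [← Real.rpow_add hdw]; congr 1; ring
          rw [← mul_assoc, ← ENNReal.ofReal_mul (by positivity), e1, e2,
            ENNReal.ofReal_mul hM.le, ENNReal.ofReal_mul (by positivity)]
          ring
      _ ≤ _ := by gcongr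
  have hHm : Measurable fun q : (Euc n × Euc n) × Euc n => H q.1.1 q.1.2 q.2 := by
    have h1 : Measurable fun q : (Euc n × Euc n) × Euc n => K q.1.2 q.2 :=
      Measurable.comp (g := fun q : Euc n × Euc n => K q.1 q.2)
        (f := fun q : (Euc n × Euc n) × Euc n => (q.1.2, q.2)) hKm
        ((measurable_snd.comp measurable_fst).prodMk measurable_snd)
    have h2 : Measurable fun q : (Euc n × Euc n) × Euc n => m q.1.2 q.2 :=
      (hdm.comp (measurable_snd.comp measurable_fst)).max (hdm.comp measurable_snd)
    have h3 : Measurable fun q : (Euc n × Euc n) × Euc n => dist q.1.1 q.1.2 :=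
      (measurable_fst.comp measurable_fst).dist (measurable_snd.comp measurable_fst)
    exact h1.mul (((h2.max h3).pow_const _).const_mul _).ennreal_ofReal
  have hHint : ∫⁻ w, ∫⁻ x, ∫⁻ y, H w x y ≤
      ENNReal.ofReal (4 ^ (n + 1) * (2 * n * ω) / β) * J := by
    calc ∫⁻ w, ∫⁻ x, ∫⁻ y, H w x y = ∫⁻ x, ∫⁻ w, ∫⁻ y, H w x y :=
          lintegral_lintegral_swap (Measurable.lintegral_prod_right hHm).aemeasurable
      _ = ∫⁻ x, ∫⁻ y, ∫⁻ w, H w x y := by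
          refine lintegral_congr fun x => lintegral_lintegral_swap ?_
          exact (hHm.comp ((measurable_fst.prodMk measurable_const).prodMk
            measurable_snd)).aemeasurable
      _ ≤ ∫⁻ x, ∫⁻ y, ENNReal.ofReal (4 ^ (n + 1) * (2 * n * ω) / β) *
            (K x y * ENNReal.ofReal (m x y ^ (-β))) := by
          refine lintegral_mono fun x => lintegral_mono fun y => ?_
          have hm0 : 0 ≤ m x y := (hd0 x).trans (le_max_left _ _)
          rcases hm0.eq_or_lt with h | h
          · have hx : d x = 0 := le_antisymm ((le_max_left _ _).trans h.ge) (hd0 x)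
            have hy : d y = 0 := le_antisymm ((le_max_right _ _).trans h.ge) (hd0 y)
            have : K x y = 0 := by
              simp [hK, gagliardoKernel, hvd x hx, hvd y hy, Real.zero_rpow hp0.ne']
            simp [hH, this]
          · have hm1 : Measurable fun w : Euc n =>
                ENNReal.ofReal (max (m x y) (dist w x) ^ (-(n + β))) :=
              ((measurable_const.max (measurable_id.dist measurable_const)).pow_const
                _).ennreal_ofReal
            have e : ∀ w, H w x y = K x y * ENNReal.ofReal (4 ^ (n + 1)) *
                ENNReal.ofReal (max (m x y) (dist w x) ^ (-(n + β))) := by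
              intro w
              simp only [hH]
              rw [ENNReal.ofReal_mul (by positivity), mul_assoc]
            simp_rw [e]
            rw [lintegral_const_mul _ hm1]
            calc _ ≤ K x y * ENNReal.ofReal (4 ^ (n + 1)) *
                  ENNReal.ofReal (2 * n * ω / β * m x y ^ (-β)) := by
                  gcongr
                  exact lintegral_max_rpow_le hn hβ hβ1 h x
              _ = _ := by
                  rw [mul_assoc, ← ENNReal.ofReal_mul (by positivity),
                    mul_left_comm (ENNReal.ofReal _) (K x y), ← ENNReal.ofReal_mul (by positivity)]
                  congr 2
                  ring
      _ = _ := by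
          simp_rw [lintegral_const_mul' _ _ ENNReal.ofReal_ne_top]
          rfl
  have hinner : Measurable fun w => ∫⁻ y, K w y * ENNReal.ofReal (m w y ^ (-β)) :=
    Measurable.lintegral_prod_right'
      (f := fun q : Euc n × Euc n => K q.1 q.2 * ENNReal.ofReal (m q.1 q.2 ^ (-β)))
      (hKm.mul (hmm.pow_const _).ennreal_ofReal)
  calc ∫⁻ w in G, ENNReal.ofReal (|v w| ^ p / d w ^ (s * p + β))
      ≤ ∫⁻ w in G, ENNReal.ofReal M *
        ((ENNReal.ofReal 4 * ∫⁻ y, K w y * ENNReal.ofReal (m w y ^ (-β))) +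
          ∫⁻ x, ∫⁻ y, H w x y) := setLIntegral_mono' hG.measurableSet hpt
    _ ≤ ∫⁻ w, ENNReal.ofReal M *
        ((ENNReal.ofReal 4 * ∫⁻ y, K w y * ENNReal.ofReal (m w y ^ (-β))) +
          ∫⁻ x, ∫⁻ y, H w x y) := setLIntegral_le_lintegral _ _
    _ = ENNReal.ofReal M * (ENNReal.ofReal 4 * J + ∫⁻ w, ∫⁻ x, ∫⁻ y, H w x y) := by
        rw [lintegral_const_mul' _ _ ENNReal.ofReal_ne_top,
          lintegral_add_left (hinner.const_mul _),
          lintegral_const_mul' _ _ ENNReal.ofReal_ne_top]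
    _ ≤ ENNReal.ofReal M * (ENNReal.ofReal (4 / β) * J +
          ENNReal.ofReal (4 ^ (n + 1) * (2 * n * ω) / β) * J) := by
        gcongr
        exact le_div_self (by norm_num) hβ hβ1
    _ = _ := by
        rw [← add_mul, ← ENNReal.ofReal_add (by positivity) (by positivity), ← mul_assoc,
          ← ENNReal.ofReal_mul hM.le]
        congr 2
        rw [weightConst]
        ring

/-- A majorant of `log (1 + t)`, linear near zero and of order `t ^ (s / 2)` at infinity. -/
def logMajorant (s t : ℝ) : ℝ := if t ≤ 1 then t else 4 / s * t ^ (s / 2)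

theorem logMajorant_nonneg {s t : ℝ} (hs : 0 ≤ s) (ht : 0 ≤ t) : 0 ≤ logMajorant s t := by
  unfold logMajorant
  split_ifs <;> positivity

theorem measurable_logMajorant (s : ℝ) : Measurable (logMajorant s) :=
  Measurable.ite measurableSet_Iic measurable_id ((measurable_id.pow_const _).const_mul _)

theorem log_one_add_le_logMajorant {s t : ℝ} (hs : 0 < s) (hs1 : s ≤ 2) (ht : 0 ≤ t) :
    Real.log (1 + t) ≤ logMajorant s t := by
  unfold logMajorant
  split_ifs with h
  · linarith [Real.log_le_sub_one_of_pos (by linarith : 0 < 1 + t)]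
  · push Not at h
    have h1 : (1 + t) ^ (s / 2) ≤ 2 * t ^ (s / 2) := by
      calc (1 + t) ^ (s / 2) ≤ (2 * t) ^ (s / 2) := by gcongr; linarith
        _ = 2 ^ (s / 2) * t ^ (s / 2) := Real.mul_rpow (by norm_num) ht
        _ ≤ 2 ^ (1 : ℝ) * t ^ (s / 2) := by
          gcongr
          · norm_num
          · linarith
        _ = _ := by rw [Real.rpow_one]
    calc Real.log (1 + t) ≤ (1 + t) ^ (s / 2) / (s / 2) :=
          Real.log_le_rpow_div (by linarith) (by linarith)
      _ ≤ 2 * t ^ (s / 2) / (s / 2) := by gcongr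
      _ = _ := by field_simp; ring

theorem abs_mul_rpow_sub_mul_rpow_le {U V a b t L δ : ℝ} (hδ : 0 ≤ δ) (ha : 0 < a) (hb : 0 ≤ b)
    (hba : b ≤ a) (hab : a ≤ b + t) (hV : b = 0 → V = 0) (hL : Real.log (1 + t / b) ≤ L) :
    |U * a ^ δ - V * b ^ δ| * a ^ (-δ) ≤ |U - V| + δ * (|V| * L) := by
  rcases hb.eq_or_lt with h | h
  · rw [hV h.symm, zero_mul, sub_zero, sub_zero, abs_zero, zero_mul, mul_zero, add_zero, abs_mul,
      abs_of_pos (Real.rpow_pos_of_pos ha _), mul_assoc, ← Real.rpow_add ha]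
    simp
  · have e : (U * a ^ δ - V * b ^ δ) * a ^ (-δ) = (U - V) + V * (1 - (b / a) ^ δ) := by
      rw [Real.rpow_neg ha.le, Real.div_rpow hb ha.le]
      field_simp
      ring
    have h1 : (b / a) ^ δ ≤ 1 := Real.rpow_le_one (by positivity) ((div_le_one ha).2 hba) hδ
    have h2 : 1 - (b / a) ^ δ ≤ δ * L := by
      have h3 := Real.log_le_sub_one_of_pos (Real.rpow_pos_of_pos (div_pos h ha) δ)
      rw [Real.log_rpow (div_pos h ha)] at h3
      have h4 : -Real.log (b / a) ≤ Real.log (1 + t / b) := by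
        rw [← Real.log_inv, inv_div]
        apply Real.log_le_log (by positivity)
        rw [div_le_iff₀ h]
        field_simp
        linarith
      nlinarith [mul_le_mul_of_nonneg_left (h4.trans hL) hδ]
    calc |U * a ^ δ - V * b ^ δ| * a ^ (-δ) = |(U * a ^ δ - V * b ^ δ) * a ^ (-δ)| := by
          rw [abs_mul, abs_of_pos (Real.rpow_pos_of_pos ha _)]
      _ ≤ |U - V| + |V * (1 - (b / a) ^ δ)| := by rw [e]; exact abs_add_le _ _
      _ = |U - V| + |V| * (1 - (b / a) ^ δ) := by
          rw [abs_mul, abs_of_nonneg (by linarith : 0 ≤ 1 - (b / a) ^ δ)]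
      _ ≤ |U - V| + |V| * (δ * L) := by gcongr
      _ = _ := by ring

/-- The error term produced by multiplying `u` with a small power of `d`. -/
def commutatorKernel (n : ℕ) (s p : ℝ) (u d : Euc n → ℝ) (x y : Euc n) : ℝ≥0∞ :=
  ENNReal.ofReal (|u y| ^ p * logMajorant s (dist x y / d y) ^ p / dist x y ^ ((n : ℝ) + s * p))

theorem measurable_commutatorKernel {n : ℕ} {s p : ℝ} {u d : Euc n → ℝ} (hu : Measurable u)
    (hd : Measurable d) : Measurable (Function.uncurry (commutatorKernel n s p u d)) := by
  unfold commutatorKernel Function.uncurry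
  have h1 : Measurable fun q : Euc n × Euc n => |u q.2| := by
    simpa [Real.norm_eq_abs] using (hu.comp measurable_snd).norm
  have h2 : Measurable fun q : Euc n × Euc n => dist q.1 q.2 := measurable_fst.dist measurable_snd
  exact (((h1.pow_const p).mul (((measurable_logMajorant s).comp
    (h2.div (hd.comp measurable_snd))).pow_const p)).div (h2.pow_const _)).ennreal_ofReal

theorem gagliardoKernel_comm (n : ℕ) (s p : ℝ) (v : Euc n → ℝ) (x y : Euc n) :
    gagliardoKernel n s p v x y = gagliardoKernel n s p v y x := by
  rw [gagliardoKernel, gagliardoKernel, abs_sub_comm, dist_comm]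

theorem gagliardoKernel_mul_rpow_max_le {n : ℕ} {s p β : ℝ} (hs : 0 < s) (hs1 : s ≤ 2)
    (hp : 1 ≤ p) (hβ : 0 ≤ β) {u d : Euc n → ℝ} (hd0 : ∀ x, 0 ≤ d x)
    (hdlip : ∀ x y, d x ≤ d y + dist x y) (hud : ∀ x, d x = 0 → u x = 0) (x y : Euc n) :
    gagliardoKernel n s p (fun z => u z * d z ^ (β / p)) x y *
        ENNReal.ofReal (max (d x) (d y) ^ (-β)) ≤
      ENNReal.ofReal (2 ^ p) * (gagliardoKernel n s p u x y + ENNReal.ofReal (β ^ p) *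
        (commutatorKernel n s p u d x y + commutatorKernel n s p u d y x)) := by
  wlog hxy : d y ≤ d x generalizing x y
  · rw [max_comm, gagliardoKernel_comm, gagliardoKernel_comm n s p u, add_comm (commutatorKernel ..)]
    exact this y x (le_of_not_ge hxy)
  have hp0 : 0 < p := by linarith
  rw [max_eq_left hxy]
  rcases (hd0 x).eq_or_lt with h | h
  · have hy : d y = 0 := le_antisymm (hxy.trans h.ge) (hd0 y)
    simp [gagliardoKernel, hud x h.symm, hud y hy, Real.zero_rpow hp0.ne']
  set δ := β / p with hδ
  have hδ0 : 0 ≤ δ := by positivity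
  have hδβ : δ ≤ β := div_le_self hβ hp
  set t := dist x y with ht
  set L := logMajorant s (t / d y) with hL
  have htd : 0 ≤ t / d y := div_nonneg dist_nonneg (hd0 y)
  have hL0 : 0 ≤ L := logMajorant_nonneg hs.le htd
  have hmain := abs_mul_rpow_sub_mul_rpow_le (U := u x) (V := u y) hδ0 h (hd0 y) hxy
    (hdlip x y) (hud y) (log_one_add_le_logMajorant hs hs1 htd)
  rw [← ht, ← hL] at hmain
  have hreal : |u x * d x ^ δ - u y * d y ^ δ| ^ p * d x ^ (-β) ≤
      2 ^ p * (|u x - u y| ^ p + β ^ p * (|u y| ^ p * L ^ p)) := by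
    calc |u x * d x ^ δ - u y * d y ^ δ| ^ p * d x ^ (-β)
        = (|u x * d x ^ δ - u y * d y ^ δ| * d x ^ (-δ)) ^ p := by
          rw [Real.mul_rpow (abs_nonneg _) (by positivity), ← Real.rpow_mul h.le]
          congr 2
          rw [hδ]; field_simp
      _ ≤ (|u x - u y| + δ * (|u y| * L)) ^ p := by gcongr
      _ ≤ (|u x - u y| + β * (|u y| * L)) ^ p := by gcongr
      _ ≤ (2 * max |u x - u y| (β * (|u y| * L))) ^ p := by
          gcongr
          linarith [le_max_left |u x - u y| (β * (|u y| * L)),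
            le_max_right |u x - u y| (β * (|u y| * L))]
      _ = 2 ^ p * max |u x - u y| (β * (|u y| * L)) ^ p :=
          Real.mul_rpow (by norm_num) (le_max_of_le_left (abs_nonneg _))
      _ ≤ 2 ^ p * (|u x - u y| ^ p + (β * (|u y| * L)) ^ p) := by
          gcongr
          rcases max_cases |u x - u y| (β * (|u y| * L)) with ⟨e, -⟩ | ⟨e, -⟩ <;> rw [e]
          · exact le_add_of_nonneg_right (by positivity)
          · exact le_add_of_nonneg_left (by positivity)
      _ = _ := by
          rw [Real.mul_rpow hβ (by positivity), Real.mul_rpow (abs_nonneg _) hL0]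
  calc gagliardoKernel n s p (fun z => u z * d z ^ δ) x y * ENNReal.ofReal (d x ^ (-β))
      = ENNReal.ofReal (|u x * d x ^ δ - u y * d y ^ δ| ^ p * d x ^ (-β) /
          t ^ ((n : ℝ) + s * p)) := by
        rw [gagliardoKernel, ← ENNReal.ofReal_mul (by positivity), div_mul_eq_mul_div]
    _ ≤ ENNReal.ofReal (2 ^ p * (|u x - u y| ^ p / t ^ ((n : ℝ) + s * p) +
          β ^ p * (|u y| ^ p * L ^ p / t ^ ((n : ℝ) + s * p)))) := by
        apply ENNReal.ofReal_le_ofReal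
        calc _ ≤ 2 ^ p * (|u x - u y| ^ p + β ^ p * (|u y| ^ p * L ^ p)) /
              t ^ ((n : ℝ) + s * p) := by gcongr
          _ = _ := by ring
    _ = ENNReal.ofReal (2 ^ p) * (gagliardoKernel n s p u x y + ENNReal.ofReal (β ^ p) *
        commutatorKernel n s p u d x y) := by
        rw [ENNReal.ofReal_mul (by positivity), ENNReal.ofReal_add (by positivity) (by positivity),
          ENNReal.ofReal_mul (by positivity)]
        rfl
    _ ≤ _ := by gcongr; exact le_self_add

/-- The constant in `lintegral_commutatorKernel_le`. -/
def commutatorConst (n : ℕ) (s p : ℝ) : ℝ :=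
  n * volume.real (ball (0 : Euc n) 1) * (1 / (p - s * p) + (4 / s) ^ p / (s * p / 2))

theorem lintegral_commutatorKernel_le {n : ℕ} (hn : 1 ≤ n) {s p : ℝ} (hs : 0 < s) (hs1 : s < 1)
    (hp : 1 ≤ p) {u d : Euc n → ℝ} {y : Euc n} (hd : 0 ≤ d y) (hud : d y = 0 → u y = 0) :
    ∫⁻ x, commutatorKernel n s p u d x y ≤
      ENNReal.ofReal (commutatorConst n s p) * ENNReal.ofReal (|u y| ^ p / d y ^ (s * p)) := by
  have hp0 : 0 < p := by linarith
  have hps : 0 < p - s * p := by nlinarith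
  rcases hd.eq_or_lt with h | h
  · simp [commutatorKernel, hud h.symm, Real.zero_rpow hp0.ne']
  refine (lintegral_radial_le hn (a := p - s * p) (b := s * p / 2) (m := d y)
    (A := |u y| ^ p * d y ^ (-p)) (A' := |u y| ^ p * ((4 / s) ^ p * d y ^ (-(s * p / 2))))
    hps (by positivity) h (by positivity) (by positivity) y _ ?_ ?_).trans ?_
  · intro x hx
    apply ENNReal.ofReal_le_ofReal
    rw [logMajorant, if_pos ((div_le_one h).2 hx)]
    rcases (dist_nonneg (x := x) (y := y)).eq_or_lt with h0 | h0
    · rw [← h0, zero_div, Real.zero_rpow hp0.ne', mul_zero, zero_div]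
      positivity
    · apply le_of_eq
      rw [Real.div_rpow h0.le h.le, Real.rpow_neg h.le, show p - s * p - n = p - (n + s * p) by ring,
        Real.rpow_sub h0]
      ring
  · intro x hx
    have h0 : 0 < dist x y := h.trans hx
    apply ENNReal.ofReal_le_ofReal
    rw [logMajorant, if_neg (by rw [div_le_one h]; exact hx.not_ge)]
    apply le_of_eq
    rw [Real.mul_rpow (by positivity) (by positivity), ← Real.rpow_mul (by positivity),
      show s / 2 * p = s * p / 2 by ring, Real.div_rpow h0.le h.le, Real.rpow_neg h.le,
      show -(s * p / 2) - (n : ℝ) = s * p / 2 - (n + s * p) by ring, Real.rpow_sub h0]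
    ring
  · have hc : 0 ≤ commutatorConst n s p := by unfold commutatorConst; positivity
    rw [← ENNReal.ofReal_mul hc]
    apply ENNReal.ofReal_le_ofReal
    apply le_of_eq
    have e1 : d y ^ (-p) * d y ^ (p - s * p) = d y ^ (-(s * p)) := by
      rw [← Real.rpow_add h]; congr 1; ring
    have e2 : d y ^ (-(s * p / 2)) * d y ^ (-(s * p / 2)) = d y ^ (-(s * p)) := by
      rw [← Real.rpow_add h]; congr 1; ring
    calc _ = n * volume.real (ball (0 : Euc n) 1) * |u y| ^ p *
          ((d y ^ (-p) * d y ^ (p - s * p)) / (p - s * p) +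
            (4 / s) ^ p * (d y ^ (-(s * p / 2)) * d y ^ (-(s * p / 2))) / (s * p / 2)) := by ring
      _ = _ := by
        rw [e1, e2, Real.rpow_neg h.le, commutatorConst]
        ring

set_option maxHeartbeats 1000000 in
theorem lintegral_gagliardoKernel_mul_rpow_max_le {n : ℕ} (hn : 1 ≤ n) {s p β : ℝ} (hs : 0 < s)
    (hs1 : s < 1) (hp : 1 ≤ p) (hβ : 0 ≤ β) {u d : Euc n → ℝ} (hu : Measurable u)
    (hdm : Measurable d) (hd0 : ∀ x, 0 ≤ d x)
    (hdlip : ∀ x y, d x ≤ d y + dist x y) (hud : ∀ x, d x = 0 → u x = 0) :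
    ∫⁻ x, ∫⁻ y, gagliardoKernel n s p (fun z => u z * d z ^ (β / p)) x y *
        ENNReal.ofReal (max (d x) (d y) ^ (-β)) ≤
      ENNReal.ofReal (2 ^ p) * ((∫⁻ x, ∫⁻ y, gagliardoKernel n s p u x y) +
        ENNReal.ofReal (β ^ p * (2 * commutatorConst n s p)) *
          ∫⁻ x, ENNReal.ofReal (|u x| ^ p / d x ^ (s * p))) := by
  have hp0 : 0 < p := by linarith
  have hps : 0 < p - s * p := by nlinarith
  have hc : 0 ≤ commutatorConst n s p := by unfold commutatorConst; positivity
  set X := ∫⁻ x, ENNReal.ofReal (|u x| ^ p / d x ^ (s * p))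
  set C := commutatorKernel n s p u d with hC
  have hCm : Measurable (Function.uncurry C) := measurable_commutatorKernel hu hdm
  have hKm : Measurable (Function.uncurry (gagliardoKernel n s p u)) := measurable_gagliardoKernel hu
  have hinner : ∀ y, ∫⁻ x, C x y ≤
      ENNReal.ofReal (commutatorConst n s p) * ENNReal.ofReal (|u y| ^ p / d y ^ (s * p)) :=
    fun y => lintegral_commutatorKernel_le hn hs hs1 hp (hd0 y) (hud y)
  have h2 : ∫⁻ x, ∫⁻ y, C y x ≤ ENNReal.ofReal (commutatorConst n s p) * X := by
    rw [← lintegral_const_mul' _ _ ENNReal.ofReal_ne_top]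
    exact lintegral_mono hinner
  have h1 : ∫⁻ x, ∫⁻ y, C x y ≤ ENNReal.ofReal (commutatorConst n s p) * X := by
    rw [lintegral_lintegral_swap hCm.aemeasurable]
    exact h2
  have hCx : ∀ x, Measurable fun y => C x y := fun x => hCm.comp measurable_prodMk_left
  have hKx : ∀ x, Measurable fun y => gagliardoKernel n s p u x y :=
    fun x => hKm.comp measurable_prodMk_left
  have hCi : Measurable fun x => ∫⁻ y, C x y := hCm.lintegral_prod_right'
  have hKi : Measurable fun x => ∫⁻ y, gagliardoKernel n s p u x y := hKm.lintegral_prod_right'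
  calc _ ≤ ∫⁻ x, ∫⁻ y, ENNReal.ofReal (2 ^ p) * (gagliardoKernel n s p u x y +
          ENNReal.ofReal (β ^ p) * (C x y + C y x)) :=
        lintegral_mono fun x => lintegral_mono fun y =>
          gagliardoKernel_mul_rpow_max_le hs (by linarith) hp hβ hd0 hdlip hud x y
    _ = ENNReal.ofReal (2 ^ p) * ((∫⁻ x, ∫⁻ y, gagliardoKernel n s p u x y) +
          ENNReal.ofReal (β ^ p) * ((∫⁻ x, ∫⁻ y, C x y) + ∫⁻ x, ∫⁻ y, C y x)) := by
        simp_rw [lintegral_const_mul' _ _ ENNReal.ofReal_ne_top, lintegral_add_left (hKx _),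
          lintegral_const_mul' _ _ ENNReal.ofReal_ne_top, lintegral_add_left (hCx _)]
        rw [lintegral_add_left hKi, lintegral_const_mul' _ _ ENNReal.ofReal_ne_top,
          lintegral_add_left hCi]
    _ ≤ ENNReal.ofReal (2 ^ p) * ((∫⁻ x, ∫⁻ y, gagliardoKernel n s p u x y) +
          ENNReal.ofReal (β ^ p) * (ENNReal.ofReal (commutatorConst n s p) * X +
            ENNReal.ofReal (commutatorConst n s p) * X)) := by gcongr
    _ = _ := by
        rw [ENNReal.ofReal_mul (by positivity), ENNReal.ofReal_mul (by norm_num),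
          ENNReal.ofReal_ofNat]
        ring

theorem exists_mul_rpow_le_half {c e : ℝ} (hc : 0 ≤ c) (he : 0 < e) :
    ∃ β : ℝ, 0 < β ∧ β ≤ 1 ∧ c * β ^ e ≤ 1 / 2 := by
  have h : 0 < 1 / (2 * (c + 1)) := by positivity
  refine ⟨(1 / (2 * (c + 1))) ^ (1 / e), by positivity,
    Real.rpow_le_one h.le ?_ (by positivity), ?_⟩
  · rw [div_le_one (by positivity)]
    linarith
  · rw [← Real.rpow_mul h.le, one_div_mul_cancel he.ne', Real.rpow_one, mul_one_div,
      div_le_div_iff₀ (by positivity) (by norm_num)]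
    linarith

theorem lintegral_div_infDist_rpow_ne_top {n : ℕ} {p q : ℝ} (hp : 0 < p) {G : Set (Euc n)}
    (hG : IsOpen G) (hGne : Gᶜ.Nonempty) {u : Euc n → ℝ} (hu : Continuous u)
    (huc : HasCompactSupport u) (huG : tsupport u ⊆ G) :
    ∫⁻ x, ENNReal.ofReal (|u x| ^ p / infDist x Gᶜ ^ q) ≠ ∞ := by
  have hcont : ContinuousOn (fun x => |u x| ^ p / infDist x Gᶜ ^ q) (tsupport u) := by
    have hpos : ∀ x ∈ tsupport u, 0 < infDist x Gᶜ := fun x hx =>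
      (hG.isClosed_compl.notMem_iff_infDist_pos hGne).1 fun h => h (huG hx)
    refine ContinuousOn.div ?_ ?_ fun x hx => (Real.rpow_pos_of_pos (hpos x hx) _).ne'
    · exact (hu.abs.rpow_const fun x => Or.inr hp.le).continuousOn
    · exact (continuous_infDist_pt _).continuousOn.rpow_const fun x hx => Or.inl (hpos x hx).ne'
  have hInt : IntegrableOn (fun x => |u x| ^ p / infDist x Gᶜ ^ q) (tsupport u) :=
    hcont.integrableOn_compact huc
  have hInt' : Integrable (fun x => |u x| ^ p / infDist x Gᶜ ^ q) := by
    refine (integrableOn_iff_integrable_of_support_subset fun x hx => ?_).1 hInt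
    by_contra h
    exact hx (by simp [image_eq_zero_of_notMem_tsupport h, Real.zero_rpow hp.ne'])
  exact hInt'.lintegral_lt_top.ne

theorem le_mul_of_le_add_half {X A : ℝ≥0∞} (hX : X ≠ ∞) (h : X ≤ A + ENNReal.ofReal (1 / 2) * X) :
    X ≤ ENNReal.ofReal 2 * A := by
  rcases eq_or_ne A ∞ with rfl | hA
  · simp
  lift X to ℝ≥0 using hX
  lift A to ℝ≥0 using hA
  have h2 : ENNReal.ofReal (1 / 2) = ((1 / 2 : ℝ≥0) : ℝ≥0∞) := by
    rw [ENNReal.ofReal, Real.toNNReal_div (by norm_num)]; simp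
  rw [h2] at h
  have h3 : ENNReal.ofReal 2 = ((2 : ℝ≥0) : ℝ≥0∞) := by simp
  rw [h3, ← ENNReal.coe_mul, ENNReal.coe_le_coe]
  have h4 : X ≤ A + 1 / 2 * X := by exact_mod_cast h
  rw [← NNReal.coe_le_coe] at h4 ⊢
  push_cast at h4 ⊢
  linarith

theorem exists_hardy_infDist_compl {n : ℕ} (hn : 1 ≤ n) {s p σ : ℝ} (hs : 0 < s) (hs1 : s < 1)
    (hp : 1 < p) (hσ : 0 < σ) :
    ∃ c : ℝ, 0 < c ∧ ∀ G : Set (Euc n), IsOpen G → Gᶜ.Nonempty →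
      (∀ x ∈ Gᶜ, ∀ r : ℝ, 0 < r →
        ENNReal.ofReal (σ * r ^ ((n : ℝ) - s * p)) ≤ rieszCap n s p (ball x r ∩ Gᶜ)) →
      ∀ u : Euc n → ℝ, Continuous u → HasCompactSupport u → tsupport u ⊆ G →
        ∫⁻ x, ENNReal.ofReal (|u x| ^ p / infDist x Gᶜ ^ (s * p)) ≤
          ENNReal.ofReal c * ∫⁻ x, ∫⁻ y, gagliardoKernel n s p u x y := by
  have hp0 : 0 < p := by linarith
  have hps : 0 < p - s * p := by nlinarith
  have hn0 : (1 : ℝ) ≤ n := by exact_mod_cast hn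
  have hC := weightConst_pos hn s p hσ
  have hc : 0 ≤ commutatorConst n s p := by unfold commutatorConst; positivity
  set C := weightConst n s p σ with hCdef
  set c := commutatorConst n s p with hcdef
  obtain ⟨β, hβ, hβ1, hβc⟩ := exists_mul_rpow_le_half (c := C * 2 ^ p * (2 * c)) (by positivity)
    (sub_pos.2 hp)
  refine ⟨2 * (C / β * 2 ^ p), by positivity, fun G hG hGne hfat u hu huc huG => ?_⟩
  set d : Euc n → ℝ := fun x => infDist x Gᶜ with hd
  have hd0 : ∀ x, 0 ≤ d x := fun x => infDist_nonneg
  have hdc : Continuous d := continuous_infDist_pt _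
  have hu0 : ∀ x ∈ Gᶜ, u x = 0 := fun x hx =>
    image_eq_zero_of_notMem_tsupport fun h => hx (huG h)
  have hud : ∀ x, d x = 0 → u x = 0 := fun x hx =>
    hu0 x ((hG.isClosed_compl.mem_iff_infDist_zero hGne).2 hx)
  set W := ∫⁻ x, ∫⁻ y, gagliardoKernel n s p u x y with hW
  set X := ∫⁻ x, ENNReal.ofReal (|u x| ^ p / d x ^ (s * p)) with hX
  have hXtop : X ≠ ∞ := lintegral_div_infDist_rpow_ne_top hp0 hG hGne hu huc huG
  have hweight := lintegral_div_infDist_rpow_le hn hp.le hs.le (hs1.le.trans hn0) hσ hβ hβ1 hG hGne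
    hfat (v := fun x => u x * d x ^ (β / p))
    (hu.mul (hdc.rpow_const fun x => Or.inr (by positivity))) fun x hx => by simp [hu0 x hx]
  have hcomm := lintegral_gagliardoKernel_mul_rpow_max_le hn hs hs1 hp.le hβ.le hu.measurable
    hdc.measurable hd0 (fun x y => infDist_le_infDist_add_dist) hud
  have hleft : ∫⁻ x in G, ENNReal.ofReal (|u x * d x ^ (β / p)| ^ p / d x ^ (s * p + β)) = X := by
    have hsupp : Function.support (fun x => ENNReal.ofReal (|u x| ^ p / d x ^ (s * p))) ⊆ G := by
      intro x hx
      by_contra h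
      exact hx (by simp [hu0 x h, Real.zero_rpow hp0.ne'])
    rw [hX, ← setLIntegral_eq_of_support_subset hsupp]
    refine setLIntegral_congr_fun hG.measurableSet fun x hx => ?_
    have hdx : 0 < d x := (hG.isClosed_compl.notMem_iff_infDist_pos hGne).1 fun h => h hx
    rw [abs_mul, abs_of_nonneg (by positivity : 0 ≤ d x ^ (β / p)),
      Real.mul_rpow (abs_nonneg _) (by positivity), ← Real.rpow_mul hdx.le,
      div_mul_cancel₀ _ hp0.ne', Real.rpow_add hdx, mul_div_mul_right _ _ (by positivity)]
  have habs : X ≤ ENNReal.ofReal (C / β * 2 ^ p) * W + ENNReal.ofReal (1 / 2) * X := by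
    calc X ≤ ENNReal.ofReal (C / β) * (ENNReal.ofReal (2 ^ p) * (W +
          ENNReal.ofReal (β ^ p * (2 * c)) * X)) := by
          rw [← hleft]
          exact hweight.trans (by rw [hleft]; gcongr)
      _ = ENNReal.ofReal (C / β * 2 ^ p) * W +
          ENNReal.ofReal (C / β * 2 ^ p * (β ^ p * (2 * c))) * X := by
          rw [ENNReal.ofReal_mul (p := C / β * 2 ^ p) (by positivity),
            ENNReal.ofReal_mul (p := C / β) (by positivity)]
          ring
      _ ≤ _ := by
          gcongr
          calc C / β * 2 ^ p * (β ^ p * (2 * c)) = C * 2 ^ p * (2 * c) * β ^ (p - 1) := by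
                rw [Real.rpow_sub_one hβ.ne']; ring
            _ ≤ _ := hβc
  calc X ≤ ENNReal.ofReal 2 * (ENNReal.ofReal (C / β * 2 ^ p) * W) :=
        le_mul_of_le_add_half hXtop habs
    _ = _ := by rw [← mul_assoc, ← ENNReal.ofReal_mul (by norm_num)]

end FracHardy

/-- Let `1<p<∞`, `0<s<1` with `sp<n`, `n ≥ 2`, and `σ > 0`. There is
`c₀ > 0`, depending only on `s, n, p, σ`, such that for every open `G ⊊ ℝⁿ` whose
complement is `(s,p)`-uniformly fat with constant `σ` and every `u ∈ C_c^∞(G)`,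
`∫_G |u|^p dist(x,∂G)^{-sp} ≤ c₀ ∫_{ℝⁿ} ∫_{ℝⁿ} |E_G u(x)-E_G u(y)|^p |x-y|^{-(n+sp)}`. -/
theorem statement16 (n : ℕ) (hn : 2 ≤ n) (s p σ : ℝ) (hs0 : 0 < s) (hs1 : s < 1)
    (hp1 : 1 < p) (hspn : s * p < n) (hσ : 0 < σ) :
    ∃ c₀ : ℝ, 0 < c₀ ∧ ∀ (G : Set (Euc n)), IsOpen G → G ≠ Set.univ →
      (∀ x ∈ Gᶜ, ∀ r : ℝ, 0 < r →
        ENNReal.ofReal (σ * r ^ ((n : ℝ) - s * p)) ≤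
          rieszCap n s p (Metric.ball x r ∩ Gᶜ)) →
      ∀ u : Euc n → ℝ, ContDiff ℝ (⊤ : ℕ∞) u → HasCompactSupport u → tsupport u ⊆ G →
        (∫⁻ x in G, ENNReal.ofReal
            (|u x| ^ p / Metric.infDist x (frontier G) ^ (s * p))) ≤
          ENNReal.ofReal c₀ * gagliardoP n s p Set.univ (G.indicator u) := by
  have hn1 : 1 ≤ n := by omega
  obtain ⟨c₀, hc₀, h⟩ := FracHardy.exists_hardy_infDist_compl hn1 hs0 hs1 hp1 hσ
  refine ⟨c₀, hc₀, fun G hG hGne hfat u hu huc huG => ?_⟩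
  have hGc : Gᶜ.Nonempty := nonempty_compl.2 hGne
  have hind : G.indicator u = u :=
    indicator_eq_self.2 ((subset_tsupport u).trans huG)
  have hgag : gagliardoP n s p univ (G.indicator u) =
      ∫⁻ x, ∫⁻ y, FracHardy.gagliardoKernel n s p u x y := by
    simp only [gagliardoP, hind, Measure.restrict_univ, FracHardy.gagliardoKernel]
  rw [hgag]
  refine le_trans ?_ (h G hG hGc hfat u hu.continuous huc huG)
  refine (setLIntegral_mono' hG.measurableSet fun x hx => ?_).trans (setLIntegral_le_lintegral _ _)
  apply ENNReal.ofReal_le_ofReal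
  have hd : 0 < infDist x Gᶜ :=
    (hG.isClosed_compl.notMem_iff_infDist_pos hGc).1 fun h => h hx
  rcases (frontier G).eq_empty_or_nonempty with hF | hF
  · rw [hF, infDist_empty, Real.zero_rpow (by positivity), div_zero]
    positivity
  · have hsub : frontier G ⊆ Gᶜ := by
      rw [hG.frontier_eq]
      exact fun z hz => hz.2
    gcongr
    exact infDist_le_infDist_of_subset hsub hF

end
end

section
/- Let 1<p<∞ and 0<s<1 be such that sp<n, and let G ⊊ ℝⁿ be an open set, n ≥ 2. If the complement G^c is (s,p)-uniformly fat and the zero extension operator E_G is bounded, then G admits the (s,p)-Hardy inequality. -/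
open MeasureTheory Metric Set
open scoped ENNReal NNReal Topology

noncomputable section

lemma lintegral_radial_eq {n : ℕ} (hn : 1 ≤ n) (f : ℝ → ℝ) (hf0 : ∀ r, 0 ≤ r → 0 ≤ f r)
    (hf : IntegrableOn (fun r : ℝ => r ^ (n - 1) * f r) (Ioi 0)) (x : Euc n) :
    ∫⁻ w, ENNReal.ofReal (f (dist x w)) =
      ENNReal.ofReal (n * volume.real (ball (0 : Euc n) 1) *
        ∫ r in Ioi (0 : ℝ), r ^ (n - 1) * f r) := by
  have : Nonempty (Fin n) := ⟨⟨0, hn⟩⟩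
  have hfin : Module.finrank ℝ (Euc n) = n := by simp
  have : Nontrivial (Euc n) := Module.nontrivial_of_finrank_pos (R := ℝ) (by omega)
  have h1 : ∫⁻ w, ENNReal.ofReal (f (dist x w)) = ∫⁻ z : Euc n, ENNReal.ofReal (f ‖z‖) := by
    simp_rw [dist_eq_norm]
    exact lintegral_sub_left_eq_self (fun z : Euc n => ENNReal.ofReal (f ‖z‖)) x
  have hintegrable : Integrable (fun z : Euc n => f ‖z‖) volume := by
    rw [integrable_fun_norm_addHaar, hfin]
    simpa using hf
  rw [h1, ← ofReal_integral_eq_lintegral_ofReal hintegrable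
    (Filter.Eventually.of_forall fun z => hf0 _ (norm_nonneg z)), integral_fun_norm_addHaar, hfin]
  simp [mul_assoc]

/-- The integral of `|x - w|^{-n-b}` over the complement of a ball. -/
lemma lintegral_dist_rpow_tail {n : ℕ} (hn : 1 ≤ n) {b M : ℝ} (hb : 0 < b) (hM : 0 < M)
    (x : Euc n) :
    ∫⁻ w, ENNReal.ofReal ((Ioi M).indicator (fun r : ℝ => r ^ (-(n : ℝ) - b)) (dist x w)) =
      ENNReal.ofReal (n * volume.real (ball (0 : Euc n) 1) * (M ^ (-b) / b)) := by
  have key : (fun r : ℝ => r ^ (n - 1) * (Ioi M).indicator (fun r : ℝ => r ^ (-(n : ℝ) - b)) r) =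
      (Ioi M).indicator (fun r : ℝ => r ^ (-1 - b)) := by
    ext r
    by_cases hr : M < r
    · have h0 : 0 < r := hM.trans hr
      simp only [indicator, mem_Ioi, hr, if_true]
      rw [← Real.rpow_natCast, ← Real.rpow_add h0]
      congr 1
      push_cast [Nat.cast_sub hn]
      ring
    · simp [indicator, hr]
  have hsub : Ioi (0 : ℝ) ∩ Ioi M = Ioi M := by
    rw [Ioi_inter_Ioi, max_eq_right hM.le]
  rw [lintegral_radial_eq hn _ _ _ x, key, setIntegral_indicator measurableSet_Ioi, hsub,
    integral_Ioi_rpow_of_lt (by linarith) hM]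
  · congr 2
    rw [show -1 - b + 1 = -b by ring, neg_div_neg_eq]
  · intro r hr
    apply indicator_nonneg
    intro a ha
    exact Real.rpow_nonneg (hM.le.trans (le_of_lt ha)) _
  · rw [key]
    exact ((integrable_indicator_iff measurableSet_Ioi).2
      (integrableOn_Ioi_rpow_of_lt (by linarith) hM)).integrableOn

/-- The integral of `|x - w|^{-n+a}` over a ball. -/
lemma lintegral_dist_rpow_near {n : ℕ} (hn : 1 ≤ n) {a D : ℝ} (ha : 0 < a) (hD : 0 < D)
    (x : Euc n) :
    ∫⁻ w, ENNReal.ofReal ((Ioc 0 D).indicator (fun r : ℝ => r ^ (-(n : ℝ) + a)) (dist x w)) =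
      ENNReal.ofReal (n * volume.real (ball (0 : Euc n) 1) * (D ^ a / a)) := by
  have key : (fun r : ℝ => r ^ (n - 1) * (Ioc 0 D).indicator (fun r : ℝ => r ^ (-(n : ℝ) + a)) r) =
      (Ioc 0 D).indicator (fun r : ℝ => r ^ (-1 + a)) := by
    ext r
    by_cases hr : r ∈ Ioc 0 D
    · have h0 : 0 < r := hr.1
      simp only [indicator, hr, if_true]
      rw [← Real.rpow_natCast, ← Real.rpow_add h0]
      congr 1
      push_cast [Nat.cast_sub hn]
      ring
    · simp [indicator, hr]
  have hsub : Ioi (0 : ℝ) ∩ Ioc 0 D = Ioc 0 D := inter_eq_right.2 fun r hr => hr.1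
  rw [lintegral_radial_eq hn _ _ _ x, key, setIntegral_indicator measurableSet_Ioc, hsub,
    ← intervalIntegral.integral_of_le hD.le, integral_rpow (Or.inl (by linarith))]
  · congr 2
    rw [show -1 + a + 1 = a by ring, Real.zero_rpow ha.ne', sub_zero]
  · intro r hr
    exact indicator_nonneg (fun a ha => Real.rpow_nonneg ha.1.le _) _
  · rw [key]
    refine ((integrable_indicator_iff measurableSet_Ioc).2 ?_).integrableOn
    exact (intervalIntegrable_iff_integrableOn_Ioc_of_le hD.le).1
      (intervalIntegral.intervalIntegrable_rpow' (by linarith))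

lemma volume_ball_eq {n : ℕ} (x : Euc n) {r : ℝ} (hr : 0 < r) :
    volume (ball x r) = ENNReal.ofReal (volume.real (ball (0 : Euc n) 1) * r ^ (n : ℝ)) := by
  rw [Measure.addHaar_ball_of_pos _ _ hr, mul_comm, ENNReal.ofReal_mul measureReal_nonneg,
    ofReal_measureReal (measure_ball_lt_top.ne)]
  simp

lemma volumeReal_unitBall_pos (n : ℕ) : 0 < volume.real (ball (0 : Euc n) 1) :=
  ENNReal.toReal_pos (measure_ball_pos _ _ one_pos).ne' measure_ball_lt_top.ne

/-- The integrand of the Gagliardo seminorm. -/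
def gagliardoKernel (n : ℕ) (s p : ℝ) (v : Euc n → ℝ) (x y : Euc n) : ℝ≥0∞ :=
  ENNReal.ofReal (|v x - v y| ^ p / dist x y ^ ((n : ℝ) + s * p))

/-- The fractional gradient of `v` relative to the set `B`. -/
def fracGrad (n : ℕ) (s p : ℝ) (B : Set (Euc n)) (v : Euc n → ℝ) (y : Euc n) : ℝ≥0∞ :=
  (∫⁻ z in B, gagliardoKernel n s p v y z) ^ (1 / p)

lemma measurable_gagliardoKernel {n : ℕ} {s p : ℝ} {v : Euc n → ℝ} (hv : Measurable v) :
    Measurable (Function.uncurry (gagliardoKernel n s p v)) := by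
  unfold gagliardoKernel Function.uncurry
  fun_prop

lemma measurable_fracGrad {n : ℕ} {s p : ℝ} {v : Euc n → ℝ} (hv : Measurable v)
    (B : Set (Euc n)) : Measurable (fracGrad n s p B v) := by
  unfold fracGrad
  exact ((measurable_gagliardoKernel hv).lintegral_prod_right (ν := volume.restrict B)).pow_const _

lemma fracGrad_rpow {n : ℕ} {s p : ℝ} (hp : 0 < p) (B : Set (Euc n)) (v : Euc n → ℝ)
    (y : Euc n) :
    fracGrad n s p B v y ^ p = ∫⁻ z in B, gagliardoKernel n s p v y z := by
  rw [fracGrad, ← ENNReal.rpow_mul, one_div_mul_cancel hp.ne', ENNReal.rpow_one]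

lemma enorm_sub_setAverage_le {n : ℕ} {T : Set (Euc n)} (hT0 : volume T ≠ 0)
    (hT1 : volume T ≠ ∞) {v : Euc n → ℝ} (hv : IntegrableOn v T) (c : ℝ) :
    ‖c - ⨍ z in T, v z‖ₑ ≤ ∫⁻ z, ‖c - v z‖ₑ ∂((volume T)⁻¹ • volume.restrict T) := by
  have h1 : c - ⨍ z in T, v z = ⨍ z in T, (c - v z) := by
    have hc : ⨍ _ in T, c = c := setAverage_const hT0 hT1 c
    have : Fact (volume T < ∞) := ⟨hT1.lt_top⟩
    nth_rewrite 1 [← hc]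
    simp only [average_eq]
    rw [integral_sub (integrable_const c) hv, smul_sub]
  rw [h1, average_eq']
  simpa using enorm_integral_le_lintegral_enorm
    (μ := (volume.restrict T univ)⁻¹ • volume.restrict T) (fun z => c - v z)

lemma enorm_sub_setAverage_le_fracGrad {n : ℕ} {s p : ℝ} (hp : 1 ≤ p) (hs : 0 < s)
    {B T : Set (Euc n)} (hTB : T ⊆ B) (hT : MeasurableSet T) (hT1 : volume T ≠ ∞) {v : Euc n → ℝ}
    (hvm : Measurable v) (hv : IntegrableOn v T) {κ ρ : ℝ} (hκ : 0 < κ) (hρ : 0 < ρ)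
    (hvol : ENNReal.ofReal (κ * ρ ^ (n : ℝ)) ≤ volume T) {y : Euc n}
    (hy : ∀ z ∈ T, dist y z ≤ ρ) :
    ‖v y - ⨍ z in T, v z‖ₑ ≤ ENNReal.ofReal (κ ^ (-(1 / p)) * ρ ^ s) * fracGrad n s p B v y := by
  have hp0 : 0 < p := by linarith
  have hT0 : volume T ≠ 0 := by
    refine ((ENNReal.ofReal_pos.2 ?_).trans_le hvol).ne'
    positivity
  have hprob : IsProbabilityMeasure ((volume T)⁻¹ • volume.restrict T) := by
    constructor
    simp [ENNReal.inv_mul_cancel hT0 hT1]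
  refine (enorm_sub_setAverage_le hT0 hT1 hv _).trans ?_
  have hjen := eLpNorm'_le_eLpNorm'_of_exponent_le (p := 1) (q := p) one_pos hp
    ((volume T)⁻¹ • volume.restrict T) (f := fun z => v y - v z)
    ((measurable_const.sub hvm).aestronglyMeasurable)
  simp only [eLpNorm'_eq_lintegral_enorm, ENNReal.rpow_one, one_div, inv_one] at hjen
  refine hjen.trans ?_
  have hpt : ∀ z ∈ T, ‖v y - v z‖ₑ ^ p ≤
      ENNReal.ofReal (ρ ^ ((n : ℝ) + s * p)) * gagliardoKernel n s p v y z := by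
    intro z hz
    rw [gagliardoKernel, ← ENNReal.ofReal_mul (by positivity), Real.enorm_eq_ofReal_abs,
      ENNReal.ofReal_rpow_of_nonneg (abs_nonneg _) hp0.le]
    apply ENNReal.ofReal_le_ofReal
    rcases eq_or_ne y z with rfl | hne
    · simp [Real.zero_rpow hp0.ne']
    · have hd : 0 < dist y z := dist_pos.2 hne
      rw [mul_div_assoc', le_div_iff₀ (by positivity), mul_comm]
      gcongr
      exact hy z hz
  have hρn : 0 < κ * ρ ^ (n : ℝ) := by positivity
  calc (∫⁻ z, ‖v y - v z‖ₑ ^ p ∂((volume T)⁻¹ • volume.restrict T)) ^ p⁻¹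
      ≤ (ENNReal.ofReal (κ * ρ ^ (n : ℝ))⁻¹ * (ENNReal.ofReal (ρ ^ ((n : ℝ) + s * p)) *
          ∫⁻ z in B, gagliardoKernel n s p v y z)) ^ p⁻¹ := by
        rw [lintegral_smul_measure, smul_eq_mul, ENNReal.ofReal_inv_of_pos hρn]
        gcongr
        rw [← lintegral_const_mul' _ _ ENNReal.ofReal_ne_top]
        exact (setLIntegral_mono' hT hpt).trans (lintegral_mono_set hTB)
    _ = _ := by
        rw [← mul_assoc, ← ENNReal.ofReal_mul (by positivity),
          ENNReal.mul_rpow_of_nonneg _ _ (by positivity), fracGrad, one_div,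
          ENNReal.ofReal_rpow_of_nonneg (by positivity) (by positivity)]
        congr 2
        rw [Real.mul_rpow (by positivity) (by positivity), mul_inv, ← Real.rpow_neg hρ.le,
          Real.mul_rpow (by positivity) (by positivity), ← Real.rpow_mul hρ.le,
          ← Real.rpow_mul hρ.le, mul_assoc, ← Real.rpow_add hρ, Real.inv_rpow hκ.le,
          ← Real.rpow_neg hκ.le]
        congr 2
        field_simp
        ring

lemma enorm_setAverage_sub_setAverage_le {n : ℕ} {s p : ℝ} (hp : 1 ≤ p) (hs : 0 < s)
    {B S T : Set (Euc n)} (hTB : T ⊆ B) (hS : MeasurableSet S) (hT : MeasurableSet T)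
    (hS0 : volume S ≠ 0) (hS1 : volume S ≠ ∞)
    (hT1 : volume T ≠ ∞) {v : Euc n → ℝ}
    (hvm : Measurable v) (hvS : IntegrableOn v S) (hvT : IntegrableOn v T)
    {κ ρ : ℝ} (hκ : 0 < κ) (hρ : 0 < ρ)
    (hvol : ENNReal.ofReal (κ * ρ ^ (n : ℝ)) ≤ volume T)
    (hST : ∀ y ∈ S, ∀ z ∈ T, dist y z ≤ ρ) :
    ‖(⨍ z in T, v z) - ⨍ z in S, v z‖ₑ ≤
      (volume S)⁻¹ * (ENNReal.ofReal (κ ^ (-(1 / p)) * ρ ^ s) * ∫⁻ y in S, fracGrad n s p B v y) := by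
  refine (enorm_sub_setAverage_le hS0 hS1 hvS _).trans ?_
  rw [lintegral_smul_measure, smul_eq_mul, ← lintegral_const_mul' _ _ ENNReal.ofReal_ne_top]
  gcongr 1
  refine setLIntegral_mono' hS fun y hy => ?_
  rw [enorm_sub_rev]
  exact enorm_sub_setAverage_le_fracGrad hp hs hTB hT hT1 hvm hvT hκ hρ hvol (hST y hy)

lemma enorm_setAverage_sub_setAverage_le_potential {n : ℕ} {s p : ℝ} (hp : 1 ≤ p) (hs : 0 < s)
    (hsn : s ≤ n) {B S T : Set (Euc n)} (hTB : T ⊆ B) (hS : MeasurableSet S)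
    (hT : MeasurableSet T) (hS1 : volume S ≠ ∞) (hT1 : volume T ≠ ∞) {v : Euc n → ℝ}
    (hvm : Measurable v) (hvS : IntegrableOn v S) (hvT : IntegrableOn v T)
    {κ ρ : ℝ} (hκ : 0 < κ) (hρ : 0 < ρ)
    (hvolS : ENNReal.ofReal (κ * ρ ^ (n : ℝ)) ≤ volume S)
    (hvolT : ENNReal.ofReal (κ * ρ ^ (n : ℝ)) ≤ volume T)
    (hST : ∀ y ∈ S, ∀ z ∈ T, dist y z ≤ ρ) {x : Euc n}
    (hx : ∀ y ∈ S, 0 < dist x y ∧ dist x y ≤ ρ) :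
    ‖(⨍ z in T, v z) - ⨍ z in S, v z‖ₑ ≤ ENNReal.ofReal (κ⁻¹ * κ ^ (-(1 / p))) *
      ∫⁻ y in S, fracGrad n s p B v y * ENNReal.ofReal (dist x y ^ (s - (n : ℝ))) := by
  have hκρ : 0 < κ * ρ ^ (n : ℝ) := by positivity
  have hS0 : volume S ≠ 0 := ((ENNReal.ofReal_pos.2 hκρ).trans_le hvolS).ne'
  refine (enorm_setAverage_sub_setAverage_le hp hs hTB hS hT hS0 hS1 hT1 hvm hvS hvT hκ hρ hvolT
    hST).trans ?_
  calc (volume S)⁻¹ * (ENNReal.ofReal (κ ^ (-(1 / p)) * ρ ^ s) * ∫⁻ y in S, fracGrad n s p B v y)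
      ≤ ENNReal.ofReal (κ * ρ ^ (n : ℝ))⁻¹ * (ENNReal.ofReal (κ ^ (-(1 / p)) * ρ ^ s) *
          ∫⁻ y in S, fracGrad n s p B v y) := by
        rw [ENNReal.ofReal_inv_of_pos hκρ]
        gcongr
    _ = ENNReal.ofReal (κ⁻¹ * κ ^ (-(1 / p))) *
          ∫⁻ y in S, fracGrad n s p B v y * ENNReal.ofReal (ρ ^ (s - (n : ℝ))) := by
        rw [lintegral_mul_const' _ _ ENNReal.ofReal_ne_top, ← mul_assoc, mul_comm (lintegral _ _),
          ← mul_assoc, ← ENNReal.ofReal_mul (by positivity), ← ENNReal.ofReal_mul (by positivity)]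
        congr 2
        rw [Real.rpow_sub hρ]
        field_simp
    _ ≤ _ := by
        gcongr 1
        refine setLIntegral_mono' hS fun y hy => ?_
        gcongr 2
        exact Real.rpow_le_rpow_of_nonpos (hx y hy).1 (hx y hy).2 (by linarith)

lemma integrableOn_ball_of_continuous {n : ℕ} {v : Euc n → ℝ} (hv : Continuous v) (x : Euc n)
    (r : ℝ) : IntegrableOn v (ball x r) :=
  (hv.locallyIntegrable.integrableOn_isCompact (isCompact_closedBall x r)).mono_set
    ball_subset_closedBall

/-- The dyadic annulus with outer radius `R / 2 ^ k`. -/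
def dyadicAnnulus {n : ℕ} (x : Euc n) (R : ℝ) (k : ℕ) : Set (Euc n) :=
  ball x (R / 2 ^ k) \ ball x (R / 2 ^ (k + 1))

lemma measurableSet_dyadicAnnulus {n : ℕ} (x : Euc n) (R : ℝ) (k : ℕ) :
    MeasurableSet (dyadicAnnulus x R k) := measurableSet_ball.diff measurableSet_ball

lemma dyadicAnnulus_subset {n : ℕ} (x : Euc n) {R : ℝ} (hR : 0 < R) (k : ℕ) :
    dyadicAnnulus x R k ⊆ ball x R :=
  sdiff_subset.trans (ball_subset_ball (div_le_self hR.le (one_le_pow₀ one_le_two)))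

lemma volume_dyadicAnnulus_ne_top {n : ℕ} (x : Euc n) (R : ℝ) (k : ℕ) :
    volume (dyadicAnnulus x R k) ≠ ∞ :=
  (measure_mono sdiff_subset).trans_lt measure_ball_lt_top |>.ne

lemma le_volume_dyadicAnnulus {n : ℕ} (hn : 1 ≤ n) (x : Euc n) {R : ℝ} (hR : 0 < R) (k : ℕ) :
    ENNReal.ofReal (volume.real (ball (0 : Euc n) 1) / 2 * (R / 2 ^ k) ^ (n : ℝ)) ≤
      volume (dyadicAnnulus x R k) := by
  have hω := volumeReal_unitBall_pos n
  have hle : R / 2 ^ (k + 1) ≤ R / 2 ^ k := by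
    gcongr
    · norm_num
    · omega
  rw [dyadicAnnulus, measure_sdiff (ball_subset_ball hle) measurableSet_ball.nullMeasurableSet
    measure_ball_lt_top.ne, volume_ball_eq x (by positivity), volume_ball_eq x (by positivity),
    ← ENNReal.ofReal_sub _ (by positivity)]
  apply ENNReal.ofReal_le_ofReal
  have h1 : R / 2 ^ (k + 1) = (R / 2 ^ k) / 2 := by rw [pow_succ]; field_simp
  have h2 : (2 : ℝ) ≤ 2 ^ (n : ℝ) := by
    simpa using Real.rpow_le_rpow_of_exponent_le (x := 2) one_le_two
      (show (1 : ℝ) ≤ n by exact_mod_cast hn)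
  have h3 : (R / 2 ^ (k + 1)) ^ (n : ℝ) ≤ (R / 2 ^ k) ^ (n : ℝ) / 2 := by
    rw [h1, Real.div_rpow (by positivity) (by positivity)]
    gcongr
  have := mul_le_mul_of_nonneg_left h3 hω.le
  linarith

lemma pairwise_disjoint_dyadicAnnulus {n : ℕ} (x : Euc n) {R : ℝ} (hR : 0 < R) :
    Pairwise (Function.onFun Disjoint (dyadicAnnulus x R)) := by
  intro i j hij
  wlog h : i < j generalizing i j
  · exact (this hij.symm (by omega)).symm
  rw [Function.onFun, Set.disjoint_left]
  intro y hyi hyj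
  refine hyi.2 (ball_subset_ball ?_ hyj.1)
  gcongr
  · norm_num
  · omega

/-- The average of `v` over an annulus around a zero of `v` is controlled by the Riesz potential
of the fractional gradient. -/
lemma enorm_setAverage_annulus_le {n : ℕ} (hn : 1 ≤ n) {s p : ℝ} (hp : 1 ≤ p) (hs : 0 < s)
    (hs1 : s ≤ 1) :
    ∃ C : ℝ, 0 < C ∧ ∀ (v : Euc n → ℝ), Continuous v → ∀ (B : Set (Euc n)) (x : Euc n) (R : ℝ),
      0 < R → v x = 0 → ball x R ⊆ B →
      ‖⨍ z in dyadicAnnulus x R 0, v z‖ₑ ≤ ENNReal.ofReal C *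
        ∫⁻ y in B, fracGrad n s p B v y * ENNReal.ofReal (dist x y ^ (s - (n : ℝ))) := by
  have hω := volumeReal_unitBall_pos n
  set ω := volume.real (ball (0 : Euc n) 1)
  set κ : ℝ := ω / 2 / 4 ^ (n : ℝ) with hκdef
  have hκ : 0 < κ := by positivity
  have hn' : (1 : ℝ) ≤ n := by exact_mod_cast hn
  refine ⟨κ⁻¹ * κ ^ (-(1 / p)), by positivity, fun v hv B x R hR hvx hB => ?_⟩
  set A := dyadicAnnulus x R
  set m : ℕ → ℝ := fun k => ⨍ z in A k, v z with hm
  set g : Euc n → ℝ≥0∞ := fun y => fracGrad n s p B v y * ENNReal.ofReal (dist x y ^ (s - (n : ℝ)))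
  set C := ENNReal.ofReal (κ⁻¹ * κ ^ (-(1 / p))) with hC
  have hAm : ∀ k, MeasurableSet (A k) := measurableSet_dyadicAnnulus x R
  have hAB : ∀ k, A k ⊆ B := fun k => (dyadicAnnulus_subset x hR k).trans hB
  have hAint : ∀ k, IntegrableOn v (A k) := fun k =>
    (integrableOn_ball_of_continuous hv x R).mono_set (dyadicAnnulus_subset x hR k)
  have hvol : ∀ k j : ℕ, j ≤ k + 1 →
      ENNReal.ofReal (κ * (2 * (R / 2 ^ k)) ^ (n : ℝ)) ≤ volume (A j) := by
    intro k j hj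
    refine le_trans (ENNReal.ofReal_le_ofReal ?_) (le_volume_dyadicAnnulus hn x hR j)
    have h1 : (2 * (R / 2 ^ k)) = 4 * (R / 2 ^ (k + 1)) := by rw [pow_succ]; field_simp; norm_num
    rw [h1, Real.mul_rpow (by norm_num) (by positivity), hκdef]
    have h2 : ω / 2 / 4 ^ (n : ℝ) * (4 ^ (n : ℝ) * (R / 2 ^ (k + 1)) ^ (n : ℝ)) =
      ω / 2 * (R / 2 ^ (k + 1)) ^ (n : ℝ) := by field_simp
    rw [h2]
    gcongr
    norm_num
  have hstep : ∀ k, ‖m k - m (k + 1)‖ₑ ≤ C * ∫⁻ y in A (k + 1), g y := by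
    intro k
    have hk : 0 < R / 2 ^ k := by positivity
    refine enorm_setAverage_sub_setAverage_le_potential (ρ := 2 * (R / 2 ^ k)) hp hs
      (by linarith) (hAB k) (hAm _) (hAm _)
      (volume_dyadicAnnulus_ne_top x R _) (volume_dyadicAnnulus_ne_top x R _) hv.measurable
      (hAint _) (hAint _) hκ (by positivity) (hvol k _ le_rfl) (hvol k _ (by omega)) ?_ ?_
    · intro y hy z hz
      have hy1 := hy.1
      have hz1 := hz.1
      rw [mem_ball] at hy1 hz1
      have : R / 2 ^ (k + 1) ≤ R / 2 ^ k := by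
        gcongr
        · norm_num
        · omega
      linarith [dist_triangle_right y z x]
    · intro y hy
      have hy1 := hy.1
      have hy2 := hy.2
      rw [mem_ball, dist_comm] at hy1 hy2
      have : R / 2 ^ (k + 1) ≤ R / 2 ^ k := by
        gcongr
        · norm_num
        · omega
      have : 0 < R / 2 ^ (k + 1 + 1) := by positivity
      constructor <;> linarith
  have hsum : ∀ N, ‖m 0 - m N‖ₑ ≤ C * ∑ k ∈ Finset.range N, ∫⁻ y in A (k + 1), g y := by
    intro N
    induction N with
    | zero => simp
    | succ N ih =>
      rw [Finset.sum_range_succ, mul_add, ← sub_add_sub_cancel (m 0) (m N)]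
      exact (enorm_add_le _ _).trans (add_le_add ih (hstep N))
  have hsum' : ∀ N, ∑ k ∈ Finset.range N, ∫⁻ y in A (k + 1), g y ≤ ∫⁻ y in B, g y := by
    intro N
    refine (ENNReal.sum_le_tsum _).trans ?_
    rw [← lintegral_iUnion (fun k => hAm _)
      ((pairwise_disjoint_dyadicAnnulus x hR).comp_of_injective (add_left_injective 1))]
    exact lintegral_mono_set (iUnion_subset fun k => hAB _)
  refine ENNReal.le_of_forall_pos_le_add fun ε hε _ => ?_
  obtain ⟨δ, hδ, hball⟩ := Metric.continuous_iff.1 hv x ε (by exact_mod_cast hε)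
  obtain ⟨N, hN⟩ := exists_pow_lt_of_lt_one (div_pos hδ hR) (show (1 / 2 : ℝ) < 1 by norm_num)
  have hNδ : R / 2 ^ N < δ := by
    rw [lt_div_iff₀ hR] at hN
    calc R / 2 ^ N = (1 / 2) ^ N * R := by rw [one_div, inv_pow]; field_simp
      _ < δ := hN
  have hA0 : volume (A N) ≠ 0 := by
    refine ((ENNReal.ofReal_pos.2 ?_).trans_le (le_volume_dyadicAnnulus hn x hR N)).ne'
    positivity
  have hA1 : volume (A N) ≠ ∞ := volume_dyadicAnnulus_ne_top x R N
  have hmN : ‖m N‖ₑ ≤ ε := by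
    have h := enorm_sub_setAverage_le hA0 hA1 (hAint N) 0
    simp only [zero_sub, enorm_neg] at h
    refine h.trans ?_
    rw [lintegral_smul_measure, smul_eq_mul]
    calc (volume (A N))⁻¹ * ∫⁻ z in A N, ‖v z‖ₑ ≤ (volume (A N))⁻¹ * ∫⁻ z in A N, ε := by
          gcongr 1
          refine setLIntegral_mono' (hAm N) fun z hz => ?_
          have hz1 := hball z ((mem_ball.1 hz.1).trans hNδ)
          rw [hvx, dist_zero_right] at hz1
          exact enorm_le_coe.2 (by exact_mod_cast hz1.le)
      _ = ε := by
          rw [setLIntegral_const, mul_comm (ε : ℝ≥0∞), ← mul_assoc,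
            ENNReal.inv_mul_cancel hA0 hA1, one_mul]
  calc ‖m 0‖ₑ = ‖(m 0 - m N) + m N‖ₑ := by rw [sub_add_cancel]
    _ ≤ ‖m 0 - m N‖ₑ + ‖m N‖ₑ := enorm_add_le _ _
    _ ≤ C * (∫⁻ y in B, g y) + ε :=
        add_le_add ((hsum N).trans (by gcongr; exact hsum' N)) hmN

lemma ENNReal.le_two_mul_of_le_add {V a q : ℝ≥0∞} (h : V ≤ a + q) (ha : 2 * a < V) :
    V ≤ 2 * q := by
  by_contra! hq
  have h1 : 2 * a + 2 * q < V + V := ENNReal.add_lt_add ha hq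
  rw [← mul_add, ← two_mul] at h1
  exact absurd h (not_le.2 (lt_of_mul_lt_mul_left' h1))

/-- A function bounded below by a constant plus a Riesz potential controls the Riesz capacity. -/
lemma rieszCap_le_of_le_potential {n : ℕ} {s p : ℝ} (hp : 0 < p) {B E : Set (Euc n)}
    (hB : MeasurableSet B) {D : Euc n → ℝ≥0∞} (hD : Measurable D)
    (hI : ∫⁻ y in B, D y ^ p ≠ ∞) {c : ℝ} (hc : 0 ≤ c)
    (h : ∀ x ∈ E, 1 ≤ ENNReal.ofReal c *
      ∫⁻ y in B, D y * ENNReal.ofReal (dist x y ^ (s - (n : ℝ)))) :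
    rieszCap n s p E ≤ ENNReal.ofReal (c ^ p) * ∫⁻ y in B, D y ^ p := by
  have hfin : ∀ᵐ y ∂(volume.restrict B), D y ≠ ∞ := by
    filter_upwards [ae_lt_top (hD.pow_const p) hI] with y hy h0
    simp [h0, hp] at hy
  set f : Euc n → ℝ := B.indicator fun y => c * (D y).toReal with hf
  have hfm : Measurable f := (hD.ennreal_toReal.const_mul c).indicator hB
  have hf0 : ∀ x, 0 ≤ f x := indicator_nonneg fun y _ => mul_nonneg hc ENNReal.toReal_nonneg
  have hfB : ∀ᵐ y ∂(volume.restrict B), ENNReal.ofReal (f y) = ENNReal.ofReal c * D y := by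
    filter_upwards [hfin, ae_restrict_mem hB] with y hy hyB
    rw [hf, indicator_of_mem hyB, ENNReal.ofReal_mul hc, ENNReal.ofReal_toReal hy]
  unfold rieszCap
  refine (iInf₂_le_of_le f hfm (iInf₂_le_of_le hf0 ?_ le_rfl)).trans ?_
  · intro x hx
    refine (h x hx).trans ?_
    rw [← lintegral_const_mul' _ _ ENNReal.ofReal_ne_top]
    refine le_trans (le_of_eq ?_) (setLIntegral_le_lintegral B _)
    refine lintegral_congr_ae ?_
    filter_upwards [hfB] with y hy
    rw [hy, mul_assoc]
  · rw [← lintegral_const_mul' _ _ ENNReal.ofReal_ne_top, ← lintegral_indicator hB]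
    refine lintegral_mono fun x => ?_
    by_cases hx : x ∈ B
    · rw [hf]
      simp only [indicator_of_mem hx]
      rw [Real.mul_rpow hc ENNReal.toReal_nonneg, ENNReal.ofReal_mul (by positivity),
        ← ENNReal.ofReal_rpow_of_nonneg ENNReal.toReal_nonneg hp.le]
      gcongr
      exact ENNReal.ofReal_toReal_le
    · simp [hf, indicator_of_notMem hx, Real.zero_rpow hp.ne']

lemma ofReal_rpow_le_local {n : ℕ} (hn : 1 ≤ n) {s p : ℝ} (hp : 1 ≤ p) (hs : 0 < s)
    (hs1 : s ≤ 1) {G : Set (Euc n)} (hfat : UniformlyFat n s p Gᶜ) :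
    ∃ C : ℝ, 0 < C ∧ ∀ v : Euc n → ℝ, Continuous v → (∀ x ∈ Gᶜ, v x = 0) →
      ∀ (w x₀ : Euc n) (d : ℝ), 0 < d → x₀ ∈ Gᶜ → dist w x₀ ≤ d → ∀ y ∈ ball w d,
      ENNReal.ofReal (|v y| ^ p) ≤
        ENNReal.ofReal (C * d ^ (s * p)) *
          (∫⁻ z in ball w (4 * d), gagliardoKernel n s p v y z) +
        ENNReal.ofReal (C * d ^ (s * p - n)) *
          ∫⁻ y in ball w (4 * d), ∫⁻ z in ball w (4 * d), gagliardoKernel n s p v y z := by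
  obtain ⟨σ, hσ, hfat⟩ := hfat
  obtain ⟨C₂, hC₂, hpot⟩ := enorm_setAverage_annulus_le hn (p := p) hp hs hs1
  have hp0 : 0 < p := by linarith
  have hω := volumeReal_unitBall_pos n
  set ω := volume.real (ball (0 : Euc n) 1)
  set κ : ℝ := ω / 2 / 4 ^ (n : ℝ) with hκdef
  have hκ : 0 < κ := by positivity
  set C₁ : ℝ := κ ^ (-(1 / p)) * 4 ^ s with hC₁def
  have hC₁ : 0 < C₁ := by positivity
  refine ⟨(2 * C₁) ^ p + (2 * C₂) ^ p / σ, by positivity,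
    fun v hv hv0 w x₀ d hd hx₀ hwx₀ y hy => ?_⟩
  set B := ball w (4 * d) with hB
  set D := fracGrad n s p B v with hDdef
  have hDm : Measurable D := measurable_fracGrad hv.measurable B
  have hDp : ∀ y, D y ^ p = ∫⁻ z in B, gagliardoKernel n s p v y z := fracGrad_rpow hp0 B v
  simp_rw [← hDp]
  set I := ∫⁻ y in B, D y ^ p with hI
  by_cases hcase : ‖v y‖ₑ ≤ 2 * (ENNReal.ofReal (C₁ * d ^ s) * D y)
  · refine le_add_right ?_
    have h1 := ENNReal.rpow_le_rpow hcase hp0.le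
    rw [Real.enorm_eq_ofReal_abs, ENNReal.ofReal_rpow_of_nonneg (abs_nonneg _) hp0.le] at h1
    refine h1.trans ?_
    rw [← mul_assoc, ENNReal.mul_rpow_of_nonneg _ _ hp0.le]
    gcongr
    rw [show (2 : ℝ≥0∞) = ENNReal.ofReal 2 by simp, ← ENNReal.ofReal_mul (by norm_num),
      ENNReal.ofReal_rpow_of_nonneg (by positivity) hp0.le]
    apply ENNReal.ofReal_le_ofReal
    rw [← mul_assoc, Real.mul_rpow (by positivity) (by positivity), ← Real.rpow_mul hd.le]
    gcongr
    exact le_add_of_nonneg_right (by positivity)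
  · refine le_add_left ?_
    rw [not_le] at hcase
    have hvy : 0 < |v y| := by
      by_contra! h
      have : v y = 0 := abs_nonpos_iff.1 h
      simp [this] at hcase
    by_cases hItop : I = ∞
    · rw [hItop, ENNReal.mul_top]
      · exact le_top
      · exact (ENNReal.ofReal_pos.2 (by positivity)).ne'
    have hE : ∀ x ∈ ball x₀ d ∩ Gᶜ, 1 ≤ ENNReal.ofReal (2 * C₂ / |v y|) *
        ∫⁻ z in B, D z * ENNReal.ofReal (dist x z ^ (s - (n : ℝ))) := by
      intro x hx
      have hxB : ball x d ⊆ B := by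
        intro z hz
        have h1 := hx.1
        rw [mem_ball] at hz h1 ⊢
        linarith [dist_triangle4 z x x₀ w, dist_comm w x₀]
      have hsub := (dyadicAnnulus_subset x hd 0)
      have h1 : ‖v y - ⨍ z in dyadicAnnulus x d 0, v z‖ₑ ≤
          ENNReal.ofReal (κ ^ (-(1 / p)) * (4 * d) ^ s) * D y := by
        refine enorm_sub_setAverage_le_fracGrad hp hs (hsub.trans hxB)
          (measurableSet_dyadicAnnulus x d 0) (volume_dyadicAnnulus_ne_top x d 0) hv.measurable
          ((integrableOn_ball_of_continuous hv x d).mono_set hsub) hκ (by positivity) ?_ ?_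
        · refine le_trans (le_of_eq ?_) (le_volume_dyadicAnnulus hn x hd 0)
          rw [pow_zero, div_one, Real.mul_rpow (by norm_num) hd.le, hκdef]
          congr 1
          field_simp
          rfl
        · intro z hz
          have h1 := hx.1
          have h2 := hsub hz
          rw [mem_ball] at h1 h2 hy
          have h3 := dist_triangle4 y w x₀ z
          have h4 := dist_triangle x₀ x z
          rw [dist_comm x₀ x, dist_comm x z] at h4
          linarith
      have h2 := hpot v hv B x d hd (hv0 x hx.2) hxB
      have h3 : ‖v y‖ₑ ≤ ENNReal.ofReal (C₁ * d ^ s) * D y + ENNReal.ofReal C₂ *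
          ∫⁻ z in B, D z * ENNReal.ofReal (dist x z ^ (s - (n : ℝ))) := by
        calc ‖v y‖ₑ = ‖(v y - ⨍ z in dyadicAnnulus x d 0, v z) +
              ⨍ z in dyadicAnnulus x d 0, v z‖ₑ := by rw [sub_add_cancel]
          _ ≤ _ := (enorm_add_le _ _).trans (add_le_add (h1.trans (le_of_eq ?_)) h2)
        rw [Real.mul_rpow (by norm_num) hd.le, hC₁def, mul_assoc]
      have h4 := ENNReal.le_two_mul_of_le_add h3 hcase
      have h5 : (1 : ℝ≥0∞) = ENNReal.ofReal (|v y|)⁻¹ * ‖v y‖ₑ := by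
        rw [Real.enorm_eq_ofReal_abs, ← ENNReal.ofReal_mul (by positivity),
          inv_mul_cancel₀ hvy.ne', ENNReal.ofReal_one]
      rw [h5]
      refine (mul_le_mul_right h4 _).trans (le_of_eq ?_)
      generalize (∫⁻ z in B, D z * ENNReal.ofReal (dist x z ^ (s - (n : ℝ)))) = P
      rw [← mul_assoc, ← mul_assoc, show (2 : ℝ≥0∞) = ENNReal.ofReal 2 by simp,
        ← ENNReal.ofReal_mul (by positivity), ← ENNReal.ofReal_mul (by positivity)]
      congr 2
      field_simp
    have hcap := (hfat x₀ hx₀ d hd).trans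
      (rieszCap_le_of_le_potential hp0 measurableSet_ball hDm hItop (by positivity) hE)
    have h6 : ENNReal.ofReal (|v y| ^ p) = ENNReal.ofReal (|v y| ^ p * d ^ (s * p - n) / σ) *
        ENNReal.ofReal (σ * d ^ ((n : ℝ) - s * p)) := by
      rw [← ENNReal.ofReal_mul (by positivity)]
      congr 1
      rw [show s * p - n = -((n : ℝ) - s * p) by ring, Real.rpow_neg hd.le]
      field_simp
    rw [h6]
    refine (mul_le_mul_right hcap _).trans ?_
    rw [← mul_assoc, ← ENNReal.ofReal_mul (by positivity)]
    gcongr ENNReal.ofReal ?_ * _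
    rw [Real.div_rpow (by positivity) hvy.le]
    calc |v y| ^ p * d ^ (s * p - n) / σ * ((2 * C₂) ^ p / |v y| ^ p)
        = (2 * C₂) ^ p / σ * d ^ (s * p - n) := by field_simp
      _ ≤ _ := by
        gcongr
        exact le_add_of_nonneg_left (by positivity)

/-- The local fractional Poincaré-type inequality for functions vanishing on a fat set. -/
lemma lintegral_ball_rpow_le {n : ℕ} (hn : 1 ≤ n) {s p : ℝ} (hp : 1 ≤ p) (hs : 0 < s)
    (hs1 : s ≤ 1) {G : Set (Euc n)} (hfat : UniformlyFat n s p Gᶜ) :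
    ∃ C : ℝ, 0 < C ∧ ∀ v : Euc n → ℝ, Continuous v → (∀ x ∈ Gᶜ, v x = 0) →
      ∀ (w x₀ : Euc n) (d : ℝ), 0 < d → x₀ ∈ Gᶜ → dist w x₀ ≤ d →
      ∫⁻ y in ball w d, ENNReal.ofReal (|v y| ^ p) ≤
        ENNReal.ofReal (C * d ^ (s * p)) *
          ∫⁻ y in ball w (4 * d), ∫⁻ z in ball w (4 * d), gagliardoKernel n s p v y z := by
  obtain ⟨C, hC, h⟩ := ofReal_rpow_le_local hn hp hs hs1 hfat
  have hω := volumeReal_unitBall_pos n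
  refine ⟨C + C * volume.real (ball (0 : Euc n) 1), by positivity,
    fun v hv hv0 w x₀ d hd hx₀ hwx₀ => ?_⟩
  refine (setLIntegral_mono' measurableSet_ball (h v hv hv0 w x₀ d hd hx₀ hwx₀)).trans ?_
  rw [lintegral_add_right _ measurable_const, setLIntegral_const,
    lintegral_const_mul' _ _ ENNReal.ofReal_ne_top, volume_ball_eq w hd,
    mul_right_comm, ← ENNReal.ofReal_mul (by positivity), add_mul (C : ℝ),
    ENNReal.ofReal_add (by positivity) (by positivity), add_mul (ENNReal.ofReal _)]
  refine add_le_add ?_ ?_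
  · gcongr
    linarith
  · gcongr ENNReal.ofReal ?_ * _
    refine le_of_eq ?_
    rw [Real.rpow_sub hd]
    field_simp

/-- The weight `max(d(x), d(y), |x - y|)`, where `d` is the distance to the complement of `G`. -/
def pairScale {n : ℕ} (G : Set (Euc n)) (x y : Euc n) : ℝ :=
  max (max (infDist x Gᶜ) (infDist y Gᶜ)) (dist x y)

lemma pairScale_comm {n : ℕ} (G : Set (Euc n)) (x y : Euc n) :
    pairScale G x y = pairScale G y x := by
  rw [pairScale, pairScale, max_comm (infDist x Gᶜ), dist_comm]

lemma pairScale_pos {n : ℕ} (G : Set (Euc n)) {x y : Euc n} (h : x ≠ y) : 0 < pairScale G x y :=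
  (dist_pos.2 h).trans_le (le_max_right _ _)

/-- The power `d(w) ^ e` of the distance to the complement of `G`, for `w` with
`|x - w| < d(w)`. -/
def nearWeight {n : ℕ} (G : Set (Euc n)) (e : ℝ) (x w : Euc n) : ℝ≥0∞ :=
  {w | dist x w < infDist w Gᶜ}.indicator (fun w => ENNReal.ofReal (infDist w Gᶜ ^ e)) w

/-- The power `d(w) ^ e` of the distance to the complement of `G`, for `w` with
`|x - w| < 4 d(w)` and `|y - w| < 4 d(w)`. -/
def pairWeight {n : ℕ} (G : Set (Euc n)) (e : ℝ) (x y w : Euc n) : ℝ≥0∞ :=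
  {w | dist x w < 4 * infDist w Gᶜ ∧ dist y w < 4 * infDist w Gᶜ}.indicator
    (fun w => ENNReal.ofReal (infDist w Gᶜ ^ e)) w

lemma measurable_nearWeight {n : ℕ} (G : Set (Euc n)) (e : ℝ) :
    Measurable (Function.uncurry (nearWeight G e)) := by
  have h2 : MeasurableSet {q : Euc n × Euc n | dist q.1 q.2 < infDist q.2 Gᶜ} :=
    measurableSet_lt (by fun_prop) (by fun_prop)
  have h3 : Measurable fun q : Euc n × Euc n => ENNReal.ofReal (infDist q.2 Gᶜ ^ e) := by fun_prop
  exact h3.indicator h2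

lemma measurable_pairWeight {n : ℕ} (G : Set (Euc n)) (e : ℝ) :
    Measurable fun q : Euc n × Euc n × Euc n => pairWeight G e q.1 q.2.1 q.2.2 := by
  have h2 : MeasurableSet {q : Euc n × Euc n × Euc n |
      dist q.1 q.2.2 < 4 * infDist q.2.2 Gᶜ ∧ dist q.2.1 q.2.2 < 4 * infDist q.2.2 Gᶜ} := by
    rw [ofPred_and]
    exact (measurableSet_lt (by fun_prop) (by fun_prop)).inter
      (measurableSet_lt (by fun_prop) (by fun_prop))
  have h3 : Measurable fun q : Euc n × Euc n × Euc n =>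
    ENNReal.ofReal (infDist q.2.2 Gᶜ ^ e) := by fun_prop
  exact h3.indicator h2

lemma lintegral_pairWeight_le {n : ℕ} (hn : 1 ≤ n) :
    ∃ C : ℝ, 0 < C ∧ ∀ (G : Set (Euc n)) (b : ℝ), 0 < b → b ≤ 1 → ∀ x y : Euc n, x ≠ y →
      ∫⁻ w, pairWeight G (-(n : ℝ) - b) x y w ≤
      ENNReal.ofReal (C / b * pairScale G x y ^ (-b)) := by
  have hω := volumeReal_unitBall_pos n
  set ω := volume.real (ball (0 : Euc n) 1) with hωdef
  have hn' : (1 : ℝ) ≤ n := by exact_mod_cast hn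
  refine ⟨8 ^ ((n : ℝ) + 1) * ω * (2 ^ (n : ℝ) + n), by positivity,
    fun G b hb hb1 x y hxy => ?_⟩
  set M := pairScale G x y with hM
  have hM0 : 0 < M := pairScale_pos G hxy
  have hpt : ∀ w, pairWeight G (-(n : ℝ) - b) x y w ≤
      ENNReal.ofReal (8 ^ ((n : ℝ) + 1)) *
        ((ball x (2 * M)).indicator (fun _ => ENNReal.ofReal (M ^ (-(n : ℝ) - b))) w +
        ENNReal.ofReal ((Ioi M).indicator (fun r : ℝ => r ^ (-(n : ℝ) - b)) (dist x w))) := by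
    intro w
    by_cases hw : dist x w < 4 * infDist w Gᶜ ∧ dist y w < 4 * infDist w Gᶜ
    swap
    · rw [pairWeight, indicator_of_notMem (by exact hw)]
      exact zero_le
    rw [pairWeight, indicator_of_mem (by exact hw)]
    obtain ⟨h1, h2⟩ := hw
    have hd : 0 < infDist w Gᶜ := by linarith [dist_nonneg (x := x) (y := w)]
    have hMd : M ≤ 8 * infDist w Gᶜ := by
      refine max_le (max_le ?_ ?_) ?_
      · linarith [infDist_le_infDist_add_dist (s := Gᶜ) (x := x) (y := w)]
      · linarith [infDist_le_infDist_add_dist (s := Gᶜ) (x := y) (y := w)]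
      · linarith [dist_triangle_right x y w]
    have hgen : ∀ r, 0 < r → r ≤ 8 * infDist w Gᶜ →
        ENNReal.ofReal (infDist w Gᶜ ^ (-(n : ℝ) - b)) ≤
          ENNReal.ofReal (8 ^ ((n : ℝ) + 1)) * ENNReal.ofReal (r ^ (-(n : ℝ) - b)) := by
      intro r hr hrd
      rw [← ENNReal.ofReal_mul (by positivity)]
      apply ENNReal.ofReal_le_ofReal
      calc infDist w Gᶜ ^ (-(n : ℝ) - b) ≤ (r / 8) ^ (-(n : ℝ) - b) :=
            Real.rpow_le_rpow_of_nonpos (by positivity) (by linarith) (by linarith)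
        _ = 8 ^ ((n : ℝ) + b) * r ^ (-(n : ℝ) - b) := by
            rw [Real.div_rpow hr.le (by norm_num), show (n : ℝ) + b = -(-(n : ℝ) - b) by ring,
              Real.rpow_neg (by norm_num)]
            field_simp
        _ ≤ _ := by
            gcongr
            norm_num
    by_cases hxw : M < dist x w
    · refine (hgen (dist x w) (hM0.trans hxw) (by linarith)).trans ?_
      gcongr
      rw [indicator_of_mem (s := Ioi M) (a := dist x w) hxw]
      exact le_add_left le_rfl
    · refine (hgen M hM0 hMd).trans ?_
      gcongr
      rw [indicator_of_mem (by rw [mem_ball, dist_comm]; linarith)]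
      exact le_add_right le_rfl
  refine (lintegral_mono hpt).trans ?_
  rw [lintegral_const_mul' _ _ ENNReal.ofReal_ne_top,
    lintegral_add_left (measurable_const.indicator measurableSet_ball),
    lintegral_dist_rpow_tail hn hb hM0, lintegral_indicator measurableSet_ball,
    setLIntegral_const, volume_ball_eq x (by positivity), ← ENNReal.ofReal_mul (by positivity),
    ← ENNReal.ofReal_add (by positivity) (by positivity), ← ENNReal.ofReal_mul (by positivity)]
  apply ENNReal.ofReal_le_ofReal
  have h1 : M ^ (-(n : ℝ) - b) * (ω * (2 * M) ^ (n : ℝ)) = ω * 2 ^ (n : ℝ) * M ^ (-b) := by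
    rw [Real.mul_rpow (by norm_num) hM0.le, show -(n : ℝ) - b = -b - n by ring,
      Real.rpow_sub hM0]
    field_simp
  have h2 : ω * 2 ^ (n : ℝ) * M ^ (-b) ≤ ω * 2 ^ (n : ℝ) * (M ^ (-b) / b) := by
    gcongr
    rw [le_div_iff₀ hb]
    exact mul_le_of_le_one_right (by positivity) hb1
  rw [← hωdef, h1]
  calc 8 ^ ((n : ℝ) + 1) * (ω * 2 ^ (n : ℝ) * M ^ (-b) + n * ω * (M ^ (-b) / b))
      ≤ 8 ^ ((n : ℝ) + 1) * (ω * 2 ^ (n : ℝ) * (M ^ (-b) / b) + n * ω * (M ^ (-b) / b)) := by gcongr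
    _ = _ := by ring

lemma le_lintegral_nearWeight {n : ℕ} {G : Set (Euc n)} {e e' : ℝ} (he0 : 0 ≤ e) (he : e ≤ e')
    {x : Euc n} (hx : 0 < infDist x Gᶜ) :
    ENNReal.ofReal (volume.real (ball (0 : Euc n) 1) / 4 ^ (n : ℝ) / 2 ^ e' *
      infDist x Gᶜ ^ ((n : ℝ) - e)) ≤
    ∫⁻ w, nearWeight G (-e) x w := by
  have hω := volumeReal_unitBall_pos n
  set ω := volume.real (ball (0 : Euc n) 1) with hωdef
  set d := infDist x Gᶜ with hd
  have hpt : ∀ w, (ball x (d / 4)).indicator (fun _ => ENNReal.ofReal ((2 * d) ^ (-e))) w ≤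
      nearWeight G (-e) x w := by
    intro w
    by_cases hw : w ∈ ball x (d / 4)
    swap
    · rw [indicator_of_notMem hw]
      exact zero_le
    rw [indicator_of_mem hw]
    rw [mem_ball, dist_comm] at hw
    have h1 := infDist_le_infDist_add_dist (s := Gᶜ) (x := x) (y := w)
    have h2 := infDist_le_infDist_add_dist (s := Gᶜ) (x := w) (y := x)
    rw [dist_comm w x] at h2
    rw [← hd] at h1 h2
    have hmem : w ∈ {w | dist x w < infDist w Gᶜ} := (by linarith : dist x w < infDist w Gᶜ)
    rw [nearWeight, indicator_of_mem hmem]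
    apply ENNReal.ofReal_le_ofReal
    exact Real.rpow_le_rpow_of_nonpos (by linarith) (by linarith) (by linarith)
  refine le_trans ?_ (lintegral_mono hpt)
  rw [lintegral_indicator measurableSet_ball, setLIntegral_const, volume_ball_eq x (by positivity),
    ← ENNReal.ofReal_mul (by positivity)]
  apply ENNReal.ofReal_le_ofReal
  calc ω / 4 ^ (n : ℝ) / 2 ^ e' * d ^ ((n : ℝ) - e)
      ≤ ω / 4 ^ (n : ℝ) / 2 ^ e * d ^ ((n : ℝ) - e) := by
        gcongr
        norm_num
    _ = (2 * d) ^ (-e) * (ω * (d / 4) ^ (n : ℝ)) := by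
        rw [Real.mul_rpow (by norm_num) hx.le, Real.div_rpow hx.le (by norm_num),
          Real.rpow_sub hx, Real.rpow_neg (by norm_num), Real.rpow_neg hx.le]
        field_simp

lemma lintegral_nearWeight_le {n : ℕ} {s p C : ℝ} (hC : 0 < C) {G : Set (Euc n)}
    (hG : IsOpen G) (hGne : Gᶜ.Nonempty) {v : Euc n → ℝ}
    (hloc : ∀ w x₀ : Euc n, ∀ d : ℝ, 0 < d → x₀ ∈ Gᶜ → dist w x₀ ≤ d →
      ∫⁻ x in ball w d, ENNReal.ofReal (|v x| ^ p) ≤ ENNReal.ofReal (C * d ^ (s * p)) *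
        ∫⁻ x in ball w (4 * d), ∫⁻ y in ball w (4 * d), gagliardoKernel n s p v x y)
    (b : ℝ) (w : Euc n) :
    ∫⁻ x, ENNReal.ofReal (|v x| ^ p) * nearWeight G (-((n : ℝ) + s * p + b)) x w ≤
      ENNReal.ofReal C *
        ∫⁻ x, ∫⁻ y, gagliardoKernel n s p v x y * pairWeight G (-(n : ℝ) - b) x y w := by
  by_cases hw : w ∈ G
  swap
  · have hdw : infDist w Gᶜ = 0 := infDist_zero_of_mem hw
    have : ∀ x, nearWeight G (-((n : ℝ) + s * p + b)) x w = 0 := by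
      intro x
      simp [nearWeight, indicator, hdw]
    simp only [this, mul_zero, lintegral_zero, zero_le]
  have hdw : 0 < infDist w Gᶜ :=
    (hG.isClosed_compl.notMem_iff_infDist_pos hGne).1 (fun h => h hw)
  obtain ⟨x₀, hx₀, hx₀d⟩ := hG.isClosed_compl.exists_infDist_eq_dist hGne w
  have h1 := hloc w x₀ (infDist w Gᶜ) hdw hx₀ hx₀d.ge
  have hnear : ∫⁻ x, ENNReal.ofReal (|v x| ^ p) * nearWeight G (-((n : ℝ) + s * p + b)) x w =
      ENNReal.ofReal (infDist w Gᶜ ^ (-((n : ℝ) + s * p + b))) *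
        ∫⁻ x in ball w (infDist w Gᶜ), ENNReal.ofReal (|v x| ^ p) := by
    rw [← lintegral_const_mul' _ _ ENNReal.ofReal_ne_top, ← lintegral_indicator measurableSet_ball]
    refine lintegral_congr fun x => ?_
    by_cases hx : dist x w < infDist w Gᶜ
    · simp [nearWeight, indicator, hx, mul_comm]
    · simp [nearWeight, indicator, hx]
  have hpair : ∫⁻ x, ∫⁻ y, gagliardoKernel n s p v x y * pairWeight G (-(n : ℝ) - b) x y w =
      ENNReal.ofReal (infDist w Gᶜ ^ (-(n : ℝ) - b)) *
        ∫⁻ x in ball w (4 * infDist w Gᶜ), ∫⁻ y in ball w (4 * infDist w Gᶜ),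
          gagliardoKernel n s p v x y := by
    rw [← lintegral_const_mul' _ _ ENNReal.ofReal_ne_top, ← lintegral_indicator measurableSet_ball]
    refine lintegral_congr fun x => ?_
    by_cases hx : dist x w < 4 * infDist w Gᶜ
    · rw [indicator_of_mem (by exact hx), ← lintegral_const_mul' _ _ ENNReal.ofReal_ne_top,
        ← lintegral_indicator measurableSet_ball]
      refine lintegral_congr fun y => ?_
      by_cases hy : dist y w < 4 * infDist w Gᶜ
      · simp [pairWeight, indicator, hx, hy, mul_comm]
      · simp [pairWeight, indicator, hy]
    · simp [pairWeight, indicator, hx]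
  rw [hnear, hpair]
  refine (mul_le_mul_right h1 _).trans (le_of_eq ?_)
  rw [← mul_assoc, ← mul_assoc, ← ENNReal.ofReal_mul (by positivity),
    ← ENNReal.ofReal_mul (by positivity), mul_left_comm, ← Real.rpow_add hdw]
  congr 4
  ring

lemma lintegral_rotate {n : ℕ} {Ψ : Euc n → Euc n → Euc n → ℝ≥0∞}
    (hΨ : Measurable fun q : Euc n × Euc n × Euc n => Ψ q.1 q.2.1 q.2.2) :
    ∫⁻ w, ∫⁻ x, ∫⁻ y, Ψ x y w = ∫⁻ x, ∫⁻ y, ∫⁻ w, Ψ x y w := by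
  have h1 : Measurable (Function.uncurry fun w x => ∫⁻ y, Ψ x y w) := by
    have : Measurable fun q : (Euc n × Euc n) × Euc n => Ψ q.1.2 q.2 q.1.1 :=
      hΨ.comp ((measurable_snd.comp measurable_fst).prodMk
        (measurable_snd.prodMk (measurable_fst.comp measurable_fst)))
    exact this.lintegral_prod_right'
  rw [lintegral_lintegral_swap h1.aemeasurable]
  refine lintegral_congr fun x => ?_
  have h2 : Measurable (Function.uncurry fun w y => Ψ x y w) :=
    hΨ.comp (measurable_const.prodMk (measurable_snd.prodMk measurable_fst))
  rw [lintegral_lintegral_swap h2.aemeasurable]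

/-- The weighted fractional Hardy inequality with weight exponent `b > 0`. -/
lemma weighted_hardy {n : ℕ} (hn : 1 ≤ n) {s p : ℝ} (hp : 1 ≤ p) (hs : 0 < s)
    (hs1 : s ≤ 1) {G : Set (Euc n)} (hG : IsOpen G) (hGne : Gᶜ.Nonempty)
    (hfat : UniformlyFat n s p Gᶜ) :
    ∃ C : ℝ, 0 < C ∧ ∀ b : ℝ, 0 < b → b ≤ 1 → ∀ v : Euc n → ℝ, Continuous v →
      (∀ x ∈ Gᶜ, v x = 0) →
      ∫⁻ x in G, ENNReal.ofReal (|v x| ^ p * infDist x Gᶜ ^ (-(s * p) - b)) ≤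
        ENNReal.ofReal (C / b) *
          ∫⁻ x, ∫⁻ y, gagliardoKernel n s p v x y * ENNReal.ofReal (pairScale G x y ^ (-b)) := by
  obtain ⟨C₁, hC₁, hloc⟩ := lintegral_ball_rpow_le hn hp hs hs1 hfat
  obtain ⟨C₂, hC₂, hker⟩ := lintegral_pairWeight_le hn
  have hp0 : 0 < p := by linarith
  have hω := volumeReal_unitBall_pos n
  set c₀ := volume.real (ball (0 : Euc n) 1) / 4 ^ (n : ℝ) / 2 ^ ((n : ℝ) + s * p + 1) with hc₀def
  have hc₀ : 0 < c₀ := by positivity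
  refine ⟨c₀⁻¹ * (C₁ * C₂), by positivity, fun b hb hb1 v hv hv0 => ?_⟩
  have hdpos : ∀ x ∈ G, 0 < infDist x Gᶜ := fun x hx =>
    (hG.isClosed_compl.notMem_iff_infDist_pos hGne).1 (fun h => h hx)
  have hlow : ENNReal.ofReal c₀ *
      ∫⁻ x in G, ENNReal.ofReal (|v x| ^ p * infDist x Gᶜ ^ (-(s * p) - b)) ≤
      ∫⁻ x, ∫⁻ w, ENNReal.ofReal (|v x| ^ p) * nearWeight G (-((n : ℝ) + s * p + b)) x w := by
    rw [← lintegral_const_mul' _ _ ENNReal.ofReal_ne_top]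
    refine le_trans ?_ (setLIntegral_le_lintegral G _)
    refine setLIntegral_mono' hG.measurableSet fun x hx => ?_
    have hdx := hdpos x hx
    rw [lintegral_const_mul' _ _ ENNReal.ofReal_ne_top, ENNReal.ofReal_mul (by positivity),
      mul_left_comm, ← ENNReal.ofReal_mul hc₀.le]
    gcongr
    have := le_lintegral_nearWeight (G := G) (x := x) (e := (n : ℝ) + s * p + b)
      (e' := (n : ℝ) + s * p + 1) (by positivity) (by linarith) hdx
    rwa [show (n : ℝ) - (n + s * p + b) = -(s * p) - b by ring, ← hc₀def] at this
  have hnear : Measurable (Function.uncurry fun x w =>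
      ENNReal.ofReal (|v x| ^ p) * nearWeight G (-((n : ℝ) + s * p + b)) x w) := by
    have h1 : Measurable fun q : Euc n × Euc n => ENNReal.ofReal (|v q.1| ^ p) := by
      have := hv.measurable
      fun_prop
    exact h1.mul (measurable_nearWeight G _)
  have hpair : Measurable fun q : Euc n × Euc n × Euc n =>
      gagliardoKernel n s p v q.1 q.2.1 * pairWeight G (-(n : ℝ) - b) q.1 q.2.1 q.2.2 := by
    have h1 := (measurable_gagliardoKernel (s := s) (p := p) hv.measurable).comp
      (measurable_fst.prodMk (measurable_fst.comp measurable_snd) :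
        Measurable fun q : Euc n × Euc n × Euc n => (q.1, q.2.1))
    exact h1.mul (measurable_pairWeight G _)
  have hup : ∫⁻ x, ∫⁻ y, ∫⁻ w,
        gagliardoKernel n s p v x y * pairWeight G (-(n : ℝ) - b) x y w ≤
      ENNReal.ofReal (C₂ / b) *
      ∫⁻ x, ∫⁻ y, gagliardoKernel n s p v x y * ENNReal.ofReal (pairScale G x y ^ (-b)) := by
    rw [← lintegral_const_mul' _ _ ENNReal.ofReal_ne_top]
    refine lintegral_mono fun x => ?_
    rw [← lintegral_const_mul' _ _ ENNReal.ofReal_ne_top]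
    refine lintegral_mono fun y => ?_
    rcases eq_or_ne x y with rfl | hxy
    · simp [gagliardoKernel, Real.zero_rpow hp0.ne']
    · have hk : gagliardoKernel n s p v x y ≠ ∞ := ENNReal.ofReal_ne_top
      rw [lintegral_const_mul' _ _ hk, mul_left_comm, ← ENNReal.ofReal_mul (by positivity)]
      gcongr
      exact hker G b hb hb1 x y hxy
  have hchain : ENNReal.ofReal c₀ *
      ∫⁻ x in G, ENNReal.ofReal (|v x| ^ p * infDist x Gᶜ ^ (-(s * p) - b)) ≤ ENNReal.ofReal C₁ *
        (ENNReal.ofReal (C₂ / b) *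
      ∫⁻ x, ∫⁻ y, gagliardoKernel n s p v x y * ENNReal.ofReal (pairScale G x y ^ (-b))) := by
    refine hlow.trans ?_
    rw [lintegral_lintegral_swap hnear.aemeasurable]
    refine (lintegral_mono
      (lintegral_nearWeight_le hC₁ hG hGne (hloc v hv hv0) b)).trans ?_
    rw [lintegral_const_mul' _ _ ENNReal.ofReal_ne_top, lintegral_rotate hpair]
    gcongr
  have h1 : (1 : ℝ≥0∞) = ENNReal.ofReal c₀⁻¹ * ENNReal.ofReal c₀ := by
    rw [← ENNReal.ofReal_mul (by positivity), inv_mul_cancel₀ hc₀.ne', ENNReal.ofReal_one]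
  calc ∫⁻ x in G, ENNReal.ofReal (|v x| ^ p * infDist x Gᶜ ^ (-(s * p) - b))
      = ENNReal.ofReal c₀⁻¹ * (ENNReal.ofReal c₀ *
        ∫⁻ x in G, ENNReal.ofReal (|v x| ^ p * infDist x Gᶜ ^ (-(s * p) - b))) := by
        rw [← mul_assoc, ← h1, one_mul]
    _ ≤ _ := mul_le_mul_right hchain _
    _ = _ := by
        rw [← mul_assoc, ← mul_assoc, ← ENNReal.ofReal_mul (by positivity),
          ← ENNReal.ofReal_mul (by positivity)]
        congr 2
        ring

lemma Real.log_one_add_rpow_le {t η p : ℝ} (ht : 0 ≤ t) (hη : 0 < η) (hη1 : η ≤ 1) (hp : 0 ≤ p) :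
    Real.log (1 + t) ^ p ≤ η⁻¹ ^ p * t ^ (η * p) := by
  have h0 : 0 ≤ Real.log (1 + t) := Real.log_nonneg (by linarith)
  have h1 : η * Real.log (1 + t) ≤ t ^ η := by
    rw [← Real.log_rpow (by linarith)]
    have h2 : (1 + t) ^ η ≤ 1 + t ^ η := by
      simpa using Real.rpow_add_le_add_rpow zero_le_one ht hη.le hη1
    have h3 : 0 < (1 + t) ^ η := by positivity
    linarith [Real.log_le_sub_one_of_pos h3]
  rw [Real.rpow_mul ht, ← Real.mul_rpow (by positivity) (by positivity)]
  refine Real.rpow_le_rpow h0 ?_ hp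
  rwa [inv_mul_eq_div, le_div_iff₀ hη, mul_comm]

lemma lintegral_log_rpow_le {n : ℕ} (hn : 1 ≤ n) {s p : ℝ} (hp : 1 ≤ p) (hs : 0 < s)
    (hs1 : s < 1) :
    ∃ C : ℝ, 0 < C ∧ ∀ (y : Euc n) (h : ℝ), 0 < h →
      ∫⁻ x, ENNReal.ofReal (Real.log (1 + dist y x / h) ^ p / dist y x ^ ((n : ℝ) + s * p)) ≤
        ENNReal.ofReal (C * h ^ (-(s * p))) := by
  have hω := volumeReal_unitBall_pos n
  have hp0 : 0 < p := by linarith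
  have hn' : (1 : ℝ) ≤ n := by exact_mod_cast hn
  set ω := volume.real (ball (0 : Euc n) 1) with hωdef
  have ha : 0 < p * (1 - s) := mul_pos hp0 (by linarith)
  have hb : 0 < s / 2 * p := by positivity
  refine ⟨n * ω / (p * (1 - s)) + (s / 2)⁻¹ ^ p * (n * ω / (s / 2 * p)), by positivity,
    fun y h hh => ?_⟩
  have hpt : ∀ x, ENNReal.ofReal
      (Real.log (1 + dist y x / h) ^ p / dist y x ^ ((n : ℝ) + s * p)) ≤
      ENNReal.ofReal (h ^ (-p)) * ENNReal.ofReal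
        ((Ioc 0 h).indicator (fun r => r ^ (-(n : ℝ) + p * (1 - s))) (dist y x)) +
      ENNReal.ofReal ((s / 2)⁻¹ ^ p * h ^ (-(s / 2 * p))) * ENNReal.ofReal
        ((Ioi h).indicator (fun r => r ^ (-(n : ℝ) - s / 2 * p)) (dist y x)) := by
    intro x
    rcases eq_or_ne y x with rfl | hyx
    · simp [Real.zero_rpow hp0.ne']
    have hr : 0 < dist y x := dist_pos.2 hyx
    generalize dist y x = r at hr
    have hgen : ∀ η, 0 < η → η ≤ 1 → Real.log (1 + r / h) ^ p / r ^ ((n : ℝ) + s * p) ≤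
        η⁻¹ ^ p * h ^ (-(η * p)) * r ^ (-(n : ℝ) + (η - s) * p) := by
      intro η hη hη1
      calc Real.log (1 + r / h) ^ p / r ^ ((n : ℝ) + s * p)
          ≤ η⁻¹ ^ p * (r / h) ^ (η * p) / r ^ ((n : ℝ) + s * p) := by
            gcongr
            exact Real.log_one_add_rpow_le (by positivity) hη hη1 hp0.le
        _ = _ := by
            rw [Real.div_rpow hr.le hh.le, Real.rpow_neg hh.le,
              show -(n : ℝ) + (η - s) * p = η * p - (n + s * p) by ring, Real.rpow_sub hr]
            field_simp
    rcases le_or_gt r h with hrh | hrh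
    · refine le_add_right ?_
      rw [← ENNReal.ofReal_mul (by positivity), indicator_of_mem (mem_Ioc.2 ⟨hr, hrh⟩)]
      apply ENNReal.ofReal_le_ofReal
      refine (hgen 1 one_pos le_rfl).trans (le_of_eq ?_)
      rw [inv_one, Real.one_rpow, one_mul, one_mul, mul_comm p]
    · refine le_add_left ?_
      rw [← ENNReal.ofReal_mul (by positivity), indicator_of_mem (mem_Ioi.2 hrh)]
      apply ENNReal.ofReal_le_ofReal
      refine (hgen (s / 2) (by positivity) (by linarith)).trans (le_of_eq ?_)
      congr 2
      ring
  refine (lintegral_mono hpt).trans ?_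
  have hm : Measurable fun x : Euc n => ENNReal.ofReal (h ^ (-p)) * ENNReal.ofReal
      ((Ioc 0 h).indicator (fun r => r ^ (-(n : ℝ) + p * (1 - s))) (dist y x)) := by
    have h1 : Measurable ((Ioc 0 h).indicator (fun r : ℝ => r ^ (-(n : ℝ) + p * (1 - s)))) :=
      Measurable.indicator (by fun_prop) measurableSet_Ioc
    have h2 : Measurable fun x : Euc n => dist y x := by fun_prop
    exact (h1.comp h2).ennreal_ofReal.const_mul _
  rw [lintegral_add_left hm, lintegral_const_mul' _ _ ENNReal.ofReal_ne_top,
    lintegral_const_mul' _ _ ENNReal.ofReal_ne_top, lintegral_dist_rpow_near hn ha hh,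
    lintegral_dist_rpow_tail hn hb hh, ← ENNReal.ofReal_mul (by positivity),
    ← ENNReal.ofReal_mul (by positivity), ← ENNReal.ofReal_add (by positivity) (by positivity)]
  apply ENNReal.ofReal_le_ofReal (le_of_eq ?_)
  rw [← hωdef]
  have e1 : h ^ (-p) * h ^ (p * (1 - s)) = h ^ (-(s * p)) := by
    rw [← Real.rpow_add hh]
    congr 1
    ring
  have e2 : h ^ (-(s / 2 * p)) * h ^ (-(s / 2 * p)) = h ^ (-(s * p)) := by
    rw [← Real.rpow_add hh]
    congr 1
    ring
  rw [add_mul, ← e1]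
  nth_rewrite 2 [e1]
  rw [← e2]
  ring

lemma Real.abs_add_rpow_le {p : ℝ} (hp : 0 ≤ p) (a b : ℝ) :
    |a + b| ^ p ≤ 2 ^ p * (|a| ^ p + |b| ^ p) := by
  wlog h : |a| ≤ |b| generalizing a b
  · rw [add_comm a, add_comm (|a| ^ p)]
    exact this b a (le_of_not_ge h)
  calc |a + b| ^ p ≤ (2 * |b|) ^ p :=
        Real.rpow_le_rpow (abs_nonneg _) (by linarith [abs_add_le a b]) hp
    _ = 2 ^ p * |b| ^ p := Real.mul_rpow (by norm_num) (abs_nonneg _)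
    _ ≤ _ := by
        gcongr
        exact le_add_of_nonneg_left (by positivity)

lemma abs_mul_rpow_sub_mul_rpow_le {δ p a b dx dy r M : ℝ} (hδ : 0 < δ) (hp : 1 ≤ p)
    (hdy : 0 ≤ dy) (hxy : dy ≤ dx) (hdr : dx ≤ dy + r) (hM : dx ≤ M) (hM0 : 0 < M)
    (hb : dy = 0 → b = 0) :
    |a * dx ^ δ - b * dy ^ δ| ^ p * M ^ (-(δ * p)) ≤
      2 ^ p * (|a - b| ^ p + δ ^ p * (|b| ^ p * Real.log (1 + r / dy) ^ p)) := by
  have hp0 : 0 < p := by linarith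
  have hr : 0 ≤ r := by linarith
  have hdx : 0 ≤ dx := hdy.trans hxy
  have hlog : 0 ≤ Real.log (1 + r / dy) :=
    Real.log_nonneg (by linarith [div_nonneg hr hdy])
  have hMδ : dx ^ δ * M ^ (-δ) ≤ 1 := by
    rw [Real.rpow_neg hM0.le, ← div_eq_mul_inv, div_le_one (by positivity)]
    exact Real.rpow_le_rpow hdx hM hδ.le
  have hkey : |b| * (dx ^ δ - dy ^ δ) * M ^ (-δ) ≤ δ * (|b| * Real.log (1 + r / dy)) := by
    rcases hdy.eq_or_lt with h0 | hdy
    · simp [hb h0.symm]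
    have hdx : 0 < dx := hdy.trans_le hxy
    have h1 : dx ^ δ - dy ^ δ ≤ dx ^ δ * (δ * Real.log (1 + r / dy)) := by
      have h2 : 1 - (dy / dx) ^ δ ≤ δ * Real.log (dx / dy) := by
        have := Real.one_sub_inv_le_log_of_pos (x := (dx / dy) ^ δ) (by positivity)
        rwa [Real.log_rpow (by positivity), ← Real.inv_rpow (by positivity), inv_div] at this
      have h3 : Real.log (dx / dy) ≤ Real.log (1 + r / dy) := by
        apply Real.log_le_log (by positivity)
        rw [div_le_iff₀ hdy, add_mul, div_mul_cancel₀ _ hdy.ne']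
        linarith
      calc dx ^ δ - dy ^ δ = dx ^ δ * (1 - (dy / dx) ^ δ) := by
            rw [Real.div_rpow hdy.le hdx.le]
            field_simp
        _ ≤ dx ^ δ * (δ * Real.log (1 + r / dy)) := by
            gcongr
            exact h2.trans (by gcongr)
    calc |b| * (dx ^ δ - dy ^ δ) * M ^ (-δ)
        ≤ |b| * (dx ^ δ * (δ * Real.log (1 + r / dy))) * M ^ (-δ) := by gcongr
      _ = (δ * (|b| * Real.log (1 + r / dy))) * (dx ^ δ * M ^ (-δ)) := by ring
      _ ≤ _ := mul_le_of_le_one_right (by positivity) hMδ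
  have hmono : dy ^ δ ≤ dx ^ δ := Real.rpow_le_rpow hdy hxy hδ.le
  have hMp : M ^ (-(δ * p)) = (M ^ (-δ)) ^ p := by
    rw [← Real.rpow_mul hM0.le]
    congr 1
    ring
  have hdecomp : (a * dx ^ δ - b * dy ^ δ) * M ^ (-δ) =
      (a - b) * (dx ^ δ * M ^ (-δ)) + b * (dx ^ δ - dy ^ δ) * M ^ (-δ) := by ring
  have hMn : 0 ≤ M ^ (-δ) := by positivity
  calc |a * dx ^ δ - b * dy ^ δ| ^ p * M ^ (-(δ * p))
      = |(a * dx ^ δ - b * dy ^ δ) * M ^ (-δ)| ^ p := by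
        rw [hMp, abs_mul, abs_of_nonneg hMn, Real.mul_rpow (abs_nonneg _) hMn]
    _ ≤ 2 ^ p * (|(a - b) * (dx ^ δ * M ^ (-δ))| ^ p + |b * (dx ^ δ - dy ^ δ) * M ^ (-δ)| ^ p) := by
        rw [hdecomp]
        exact Real.abs_add_rpow_le hp0.le _ _
    _ ≤ 2 ^ p * (|a - b| ^ p + (δ * (|b| * Real.log (1 + r / dy))) ^ p) := by
        gcongr 2 ^ p * (?_ ^ p + ?_ ^ p)
        · rw [abs_mul, abs_of_nonneg (by positivity : 0 ≤ dx ^ δ * M ^ (-δ))]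
          exact mul_le_of_le_one_right (abs_nonneg _) hMδ
        · rwa [abs_mul, abs_mul, abs_of_nonneg hMn, abs_of_nonneg (sub_nonneg.2 hmono)]
    _ = _ := by
        rw [Real.mul_rpow hδ.le (by positivity), Real.mul_rpow (abs_nonneg _) hlog]

/-- The error integrand arising from replacing `u` by `u d ^ δ`. -/
def logKernel {n : ℕ} (s p : ℝ) (G : Set (Euc n)) (u : Euc n → ℝ) (x y : Euc n) : ℝ≥0∞ :=
  ENNReal.ofReal (|u y| ^ p *
    (Real.log (1 + dist y x / infDist y Gᶜ) ^ p / dist y x ^ ((n : ℝ) + s * p)))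

lemma measurable_logKernel {n : ℕ} (s p : ℝ) (G : Set (Euc n)) {u : Euc n → ℝ}
    (hu : Measurable u) : Measurable (Function.uncurry (logKernel s p G u)) := by
  unfold logKernel Function.uncurry
  fun_prop

lemma gagliardoKernel_comm {n : ℕ} (s p : ℝ) (v : Euc n → ℝ) (x y : Euc n) :
    gagliardoKernel n s p v x y = gagliardoKernel n s p v y x := by
  rw [gagliardoKernel, gagliardoKernel, abs_sub_comm, dist_comm]

lemma gagliardoKernel_mul_rpow_le {n : ℕ} {s p b : ℝ} (hp : 1 ≤ p) (hb : 0 < b)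
    {G : Set (Euc n)} {u : Euc n → ℝ}
    (hG : IsClosed Gᶜ) (hGne : Gᶜ.Nonempty) (hu : ∀ x ∈ Gᶜ, u x = 0) (x y : Euc n) :
    gagliardoKernel n s p (fun x => u x * infDist x Gᶜ ^ (b / p)) x y *
        ENNReal.ofReal (pairScale G x y ^ (-b)) ≤
      ENNReal.ofReal (2 ^ p) * (gagliardoKernel n s p u x y +
        ENNReal.ofReal ((b / p) ^ p) * (logKernel s p G u x y + logKernel s p G u y x)) := by
  have hp0 : 0 < p := by linarith
  wlog hxy : infDist y Gᶜ ≤ infDist x Gᶜ generalizing x y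
  · rw [gagliardoKernel_comm, gagliardoKernel_comm s p u, pairScale_comm,
      add_comm (logKernel s p G u x y)]
    exact this y x (le_of_not_ge hxy)
  rcases eq_or_ne x y with rfl | hne
  · simp [gagliardoKernel, Real.zero_rpow hp0.ne']
  have hr : 0 < dist x y := dist_pos.2 hne
  have key := abs_mul_rpow_sub_mul_rpow_le (δ := b / p) (a := u x) (b := u y)
    (M := pairScale G x y) (r := dist x y) (by positivity) hp infDist_nonneg hxy
    infDist_le_infDist_add_dist ((le_max_left _ _).trans (le_max_left _ _))
    (pairScale_pos G hne) (fun h => hu y ((hG.mem_iff_infDist_zero hGne).2 h))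
  rw [div_mul_cancel₀ _ hp0.ne'] at key
  have hlog : 0 ≤ Real.log (1 + dist x y / infDist y Gᶜ) :=
    Real.log_nonneg (le_add_of_nonneg_right (div_nonneg dist_nonneg infDist_nonneg))
  have hM := pairScale_pos G hne
  calc _ ≤ ENNReal.ofReal (2 ^ p) * (gagliardoKernel n s p u x y +
        ENNReal.ofReal ((b / p) ^ p) * logKernel s p G u x y) := by
        simp only [gagliardoKernel, logKernel]
        rw [dist_comm y x, ← ENNReal.ofReal_mul (by positivity),
          ← ENNReal.ofReal_mul (by positivity),
          ← ENNReal.ofReal_add (by positivity) (by positivity),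
          ← ENNReal.ofReal_mul (by positivity)]
        apply ENNReal.ofReal_le_ofReal
        rw [div_mul_eq_mul_div, div_le_iff₀ (by positivity)]
        refine key.trans (le_of_eq ?_)
        field_simp
    _ ≤ _ := by
        gcongr
        exact le_self_add

lemma lintegral_logKernel_le {n : ℕ} {s p C : ℝ}
    (hC : ∀ (y : Euc n) (h : ℝ), 0 < h →
      ∫⁻ x, ENNReal.ofReal (Real.log (1 + dist y x / h) ^ p / dist y x ^ ((n : ℝ) + s * p)) ≤
        ENNReal.ofReal (C * h ^ (-(s * p)))) (hC0 : 0 < C) (hp : 0 < p)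
    {G : Set (Euc n)} (hG : IsOpen G) (hGne : Gᶜ.Nonempty) {u : Euc n → ℝ}
    (hu : ∀ x ∈ Gᶜ, u x = 0) :
    ∫⁻ y, ∫⁻ x, logKernel s p G u x y ≤
      ENNReal.ofReal C * ∫⁻ y in G, ENNReal.ofReal (|u y| ^ p * infDist y Gᶜ ^ (-(s * p))) := by
  rw [← lintegral_const_mul' _ _ ENNReal.ofReal_ne_top, ← lintegral_indicator hG.measurableSet]
  refine lintegral_mono fun y => ?_
  by_cases hy : y ∈ G
  · have hdy : 0 < infDist y Gᶜ :=
      (hG.isClosed_compl.notMem_iff_infDist_pos hGne).1 (fun h => h hy)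
    have hup : 0 ≤ |u y| ^ p := by positivity
    rw [indicator_of_mem hy]
    simp only [logKernel, ENNReal.ofReal_mul hup]
    rw [lintegral_const_mul' _ _ ENNReal.ofReal_ne_top, mul_left_comm, ← ENNReal.ofReal_mul hC0.le]
    gcongr
    exact hC y _ hdy
  · rw [indicator_of_notMem hy]
    simp [logKernel, hu y hy, Real.zero_rpow hp.ne']

lemma lintegral_abs_rpow_mul_infDist_lt_top {n : ℕ} {s p : ℝ} (hp : 0 < p)
    {G : Set (Euc n)} (hG : IsOpen G) (hGne : Gᶜ.Nonempty) {u : Euc n → ℝ} (hu : Continuous u)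
    (huc : HasCompactSupport u) (hus : tsupport u ⊆ G) :
    ∫⁻ y in G, ENNReal.ofReal (|u y| ^ p * infDist y Gᶜ ^ (-(s * p))) < ∞ := by
  have hcont : ContinuousOn (fun y => |u y| ^ p * infDist y Gᶜ ^ (-(s * p))) (tsupport u) := by
    refine ContinuousOn.mul ?_ ?_
    · exact (hu.abs.rpow_const fun _ => Or.inr hp.le).continuousOn
    · refine (continuous_infDist_pt _).continuousOn.rpow_const fun y hy => Or.inl ?_
      exact ((hG.isClosed_compl.notMem_iff_infDist_pos hGne).1 (fun h => h (hus hy))).ne'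
  have hintegrable := hcont.integrableOn_compact (μ := volume) huc
  refine lt_of_le_of_lt ?_ hintegrable.lintegral_lt_top
  rw [← lintegral_indicator hG.measurableSet,
    ← lintegral_indicator (isClosed_tsupport u).measurableSet]
  refine lintegral_mono fun y => ?_
  by_cases hy : y ∈ tsupport u
  · rw [indicator_of_mem hy, indicator_of_mem (hus hy)]
  · simp [indicator, hy, image_eq_zero_of_notMem_tsupport hy, Real.zero_rpow hp.ne']

lemma exists_mul_rpow_le {K q : ℝ} (hK : 0 < K) (hq : 0 < q) :
    ∃ b : ℝ, 0 < b ∧ b ≤ 1 ∧ K * b ^ q ≤ 1 / 2 := by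
  refine ⟨min 1 ((1 / 2 / K) ^ q⁻¹), by positivity, min_le_left _ _, ?_⟩
  have h : min 1 ((1 / 2 / K) ^ q⁻¹) ^ q ≤ 1 / 2 / K := by
    refine (Real.rpow_le_rpow (by positivity) (min_le_right _ _) hq.le).trans (le_of_eq ?_)
    rw [← Real.rpow_mul (by positivity), inv_mul_cancel₀ hq.ne', Real.rpow_one]
  rw [le_div_iff₀ hK] at h
  linarith

lemma lintegral_lintegral_const_mul {n : ℕ} {F : Euc n → Euc n → ℝ≥0∞} {c : ℝ≥0∞} (hc : c ≠ ∞) :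
    ∫⁻ x, ∫⁻ y, c * F x y = c * ∫⁻ x, ∫⁻ y, F x y := by
  simp_rw [lintegral_const_mul' _ _ hc]

lemma lintegral_lintegral_add_left {n : ℕ} {F H : Euc n → Euc n → ℝ≥0∞}
    (hF : Measurable (Function.uncurry F)) :
    ∫⁻ x, ∫⁻ y, (F x y + H x y) = (∫⁻ x, ∫⁻ y, F x y) + ∫⁻ x, ∫⁻ y, H x y := by
  have h1 : ∀ x, ∫⁻ y, (F x y + H x y) = (∫⁻ y, F x y) + ∫⁻ y, H x y := fun x =>
    lintegral_add_left (hF.comp measurable_prodMk_left) _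
  have h2 : Measurable fun x => ∫⁻ y, F x y := hF.lintegral_prod_right'
  simp_rw [h1]
  exact lintegral_add_left h2 _

/-- The fractional Hardy inequality on an open set with uniformly fat complement, with the
seminorm over the whole space on the right-hand side. -/
lemma lintegral_infDist_rpow_le_gagliardo {n : ℕ} (hn : 1 ≤ n) {s p : ℝ} (hp : 1 < p)
    (hs : 0 < s) (hs1 : s < 1) {G : Set (Euc n)} (hG : IsOpen G) (hGne : Gᶜ.Nonempty)
    (hfat : UniformlyFat n s p Gᶜ) :
    ∃ C : ℝ, 0 < C ∧ ∀ u : Euc n → ℝ, Continuous u → HasCompactSupport u → tsupport u ⊆ G →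
      ∫⁻ x in G, ENNReal.ofReal (|u x| ^ p * infDist x Gᶜ ^ (-(s * p))) ≤
        ENNReal.ofReal C * ∫⁻ x, ∫⁻ y, gagliardoKernel n s p u x y := by
  obtain ⟨C₁, hC₁, hweight⟩ := weighted_hardy hn hp.le hs hs1.le hG hGne hfat
  obtain ⟨C₂, hC₂, hlog⟩ := lintegral_log_rpow_le hn hp.le hs hs1
  have hp0 : 0 < p := by linarith
  obtain ⟨b, hb, hb1, hbsmall⟩ := exists_mul_rpow_le
    (K := C₁ * 2 ^ p * (2 * C₂) / p ^ p) (q := p - 1) (by positivity) (by linarith)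
  refine ⟨2 * (C₁ / b * 2 ^ p), by positivity, fun u hu huc hus => ?_⟩
  have hu0 : ∀ x ∈ Gᶜ, u x = 0 := fun x hx =>
    image_eq_zero_of_notMem_tsupport fun h => hx (hus h)
  have hδ : 0 < b / p := by positivity
  have hvcont : Continuous fun x => u x * infDist x Gᶜ ^ (b / p) :=
    hu.mul ((continuous_infDist_pt _).rpow_const fun _ => Or.inr hδ.le)
  have h1 := hweight b hb hb1 _ hvcont fun x hx => by simp [hu0 x hx]
  have hleft : ∫⁻ x in G, ENNReal.ofReal (|u x * infDist x Gᶜ ^ (b / p)| ^ p *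
        infDist x Gᶜ ^ (-(s * p) - b)) =
      ∫⁻ x in G, ENNReal.ofReal (|u x| ^ p * infDist x Gᶜ ^ (-(s * p))) := by
    refine setLIntegral_congr_fun hG.measurableSet fun x hx => ?_
    have hd : 0 < infDist x Gᶜ :=
      (hG.isClosed_compl.notMem_iff_infDist_pos hGne).1 (fun h => h hx)
    have hdδ : 0 ≤ infDist x Gᶜ ^ (b / p) := by positivity
    rw [abs_mul, abs_of_nonneg hdδ, Real.mul_rpow (abs_nonneg _) hdδ, ← Real.rpow_mul hd.le,
      div_mul_cancel₀ _ hp0.ne', mul_assoc, ← Real.rpow_add hd, add_sub_cancel]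
  rw [hleft] at h1
  have hkm := measurable_gagliardoKernel (s := s) (p := p) hu.measurable
  have hlm := measurable_logKernel s p G hu.measurable
  have hA := lintegral_abs_rpow_mul_infDist_lt_top (s := s) hp0 hG hGne hu huc hus
  have hlogA := lintegral_logKernel_le hlog hC₂ hp0 hG hGne hu0
  have h2 : ∫⁻ x, ∫⁻ y, gagliardoKernel n s p (fun x => u x * infDist x Gᶜ ^ (b / p)) x y *
        ENNReal.ofReal (pairScale G x y ^ (-b)) ≤
      ENNReal.ofReal (2 ^ p) * ((∫⁻ x, ∫⁻ y, gagliardoKernel n s p u x y) +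
        ENNReal.ofReal ((b / p) ^ p) * ((∫⁻ x, ∫⁻ y, logKernel s p G u x y) +
          ∫⁻ x, ∫⁻ y, logKernel s p G u y x)) := by
    refine (lintegral_mono fun x => lintegral_mono fun y =>
      gagliardoKernel_mul_rpow_le hp.le hb hG.isClosed_compl hGne hu0 x y).trans (le_of_eq ?_)
    rw [lintegral_lintegral_const_mul ENNReal.ofReal_ne_top, lintegral_lintegral_add_left hkm,
      lintegral_lintegral_const_mul ENNReal.ofReal_ne_top, lintegral_lintegral_add_left hlm]
  have h3 : ∫⁻ x, ∫⁻ y, logKernel s p G u x y = ∫⁻ x, ∫⁻ y, logKernel s p G u y x :=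
    lintegral_lintegral_swap hlm.aemeasurable
  rw [h3] at h2
  generalize (∫⁻ x, ∫⁻ y, gagliardoKernel n s p u x y) = E at h2 ⊢
  generalize (∫⁻ x in G, ENNReal.ofReal (|u x| ^ p * infDist x Gᶜ ^ (-(s * p)))) = A at *
  have h4 : A ≤ ENNReal.ofReal (C₁ / b) * (ENNReal.ofReal (2 ^ p) * (E +
      ENNReal.ofReal ((b / p) ^ p) * (ENNReal.ofReal C₂ * A + ENNReal.ofReal C₂ * A))) := by
    refine h1.trans ?_
    gcongr
    refine h2.trans ?_
    gcongr
  rcases eq_or_ne E ∞ with rfl | hE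
  · rw [ENNReal.mul_top (ENNReal.ofReal_pos.2 (by positivity)).ne']
    exact le_top
  lift A to ℝ≥0 using hA.ne
  lift E to ℝ≥0 using hE
  rw [← ENNReal.ofReal_coe_nnreal (p := A), ← ENNReal.ofReal_coe_nnreal (p := E)] at h4 ⊢
  rw [← ENNReal.ofReal_mul (by positivity), ← ENNReal.ofReal_add (by positivity) (by positivity),
    ← ENNReal.ofReal_mul (by positivity), ← ENNReal.ofReal_add (by positivity) (by positivity),
    ← ENNReal.ofReal_mul (by positivity), ← ENNReal.ofReal_mul (by positivity),
    ENNReal.ofReal_le_ofReal_iff (by positivity)] at h4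
  rw [← ENNReal.ofReal_mul (by positivity)]
  apply ENNReal.ofReal_le_ofReal
  have h5 : C₁ / b * (2 ^ p * ((b / p) ^ p * (C₂ * A + C₂ * A))) =
      C₁ * 2 ^ p * (2 * C₂) / p ^ p * b ^ (p - 1) * A := by
    rw [Real.div_rpow hb.le hp0.le, Real.rpow_sub hb, Real.rpow_one]
    field_simp
    ring
  have h6 := mul_le_mul_of_nonneg_right hbsmall A.coe_nonneg
  rw [← h5] at h6
  linarith

/-- Every point is at least as far from the frontier of a proper nonempty open set as from its
complement. -/
lemma infDist_compl_le_infDist_frontier {n : ℕ} {G : Set (Euc n)} (hG : IsOpen G)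
    (hG0 : G.Nonempty) (hG1 : G ≠ univ) (x : Euc n) :
    infDist x Gᶜ ≤ infDist x (frontier G) := by
  refine infDist_le_infDist_of_subset ?_ (nonempty_frontier_iff.2 ⟨hG0, hG1⟩)
  rw [hG.frontier_eq]
  exact fun y hy => hy.2


/-- Let `1<p<∞`, `0<s<1` with `sp<n`, and let `G ⊊ ℝⁿ` be open, `n ≥ 2`.
If `Gᶜ` is `(s,p)`-uniformly fat and the zero extension operator `E_G` is bounded, then
`G` admits the `(s,p)`-Hardy inequality. -/
theorem statement17 (n : ℕ) (hn : 2 ≤ n) (s p : ℝ) (hs0 : 0 < s) (hs1 : s < 1)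
    (hp1 : 1 < p) (hspn : s * p < n)
    (G : Set (Euc n)) (hGopen : IsOpen G) (hGproper : G ≠ Set.univ)
    (hfat : UniformlyFat n s p Gᶜ)
    (hbdd : ∃ c₁ : ℝ, 0 < c₁ ∧ ∀ u : Euc n → ℝ,
      ContDiff ℝ (⊤ : ℕ∞) u → HasCompactSupport u → tsupport u ⊆ G →
      gagliardoP n s p Set.univ (G.indicator u) ≤
        ENNReal.ofReal c₁ * gagliardoP n s p G u) :
    AdmitsHardy n s p G := by
  obtain ⟨c₁, hc₁, hbdd⟩ := hbdd
  have hGne : Gᶜ.Nonempty := nonempty_compl.2 hGproper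
  obtain ⟨C, hC, hhardy⟩ :=
    lintegral_infDist_rpow_le_gagliardo (by linarith) hp1 hs0 hs1 hGopen hGne hfat
  refine ⟨C * c₁, by positivity, fun u hu huc hus => ?_⟩
  have hind : G.indicator u = u :=
    indicator_eq_self.2 ((subset_tsupport u).trans hus)
  have hext := hbdd u hu huc hus
  rw [hind] at hext
  calc ∫⁻ x in G, ENNReal.ofReal (|u x| ^ p / infDist x (frontier G) ^ (s * p))
      ≤ ∫⁻ x in G, ENNReal.ofReal (|u x| ^ p * infDist x Gᶜ ^ (-(s * p))) := by
        refine setLIntegral_mono' hGopen.measurableSet fun x hx => ?_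
        have hd : 0 < infDist x Gᶜ :=
          (hGopen.isClosed_compl.notMem_iff_infDist_pos hGne).1 (fun h => h hx)
        have hle := infDist_compl_le_infDist_frontier hGopen ⟨x, hx⟩ hGproper x
        rw [Real.rpow_neg hd.le, ← div_eq_mul_inv]
        gcongr
    _ ≤ ENNReal.ofReal C * ∫⁻ x, ∫⁻ y, gagliardoKernel n s p u x y :=
        hhardy u hu.continuous huc hus
    _ = ENNReal.ofReal C * gagliardoP n s p univ u := by
        simp only [gagliardoP, gagliardoKernel, Measure.restrict_univ]
    _ ≤ ENNReal.ofReal C * (ENNReal.ofReal c₁ * gagliardoP n s p G u) := by gcongr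
    _ = _ := by
        rw [← mul_assoc, ← ENNReal.ofReal_mul hC.le, gagliardoP]

end
end
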